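/- arXiv:1002.2585 — 9 statements merged into one kernel-verified Lean document; each statement's English description precedes it below -/
import Mathlib

section
/- Let X be a topological space which is the union of two subsets Y and Z, where Y is closed and discrete in X and Z (with the subspace topology) is a D-space. Then X is a D-space. -/
open Set Cardinal

/-- `X` is a D-space: every open neighborhood assignment has a closed discrete kernel. -/
def IsDSpace (X : Type*) [TopologicalSpace X] : Prop :=
  ∀ U : X → Set X, (∀ x, IsOpen (U x)) → (∀ x, x ∈ U x) →
    ∃ D : Set X, IsClosed D ∧ DiscreteTopology ↥D ∧ ⋃ d ∈ D, U d = Set.univ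

/-- The union of two disjoint closed discrete subsets is discrete. -/
theorem discreteTopology_union_of_isClosed_of_disjoint {X : Type*} [TopologicalSpace X]
    {A B : Set X} (hA : IsClosed A) (hB : IsClosed B) (hAd : DiscreteTopology ↥A)
    (hBd : DiscreteTopology ↥B) (hAB : Disjoint A B) : DiscreteTopology ↥(A ∪ B) := by
  rw [discreteTopology_subtype_iff'] at *
  rw [Set.disjoint_left] at hAB
  rintro x (hx | hx)
  · obtain ⟨O, hO, h⟩ := hAd x hx
    refine ⟨O ∩ Bᶜ, hO.inter hB.isOpen_compl, ?_⟩
    ext t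
    have := Set.ext_iff.1 h t
    simp only [mem_inter_iff, mem_union, mem_compl_iff, mem_singleton_iff] at *
    grind
  · obtain ⟨O, hO, h⟩ := hBd x hx
    refine ⟨O ∩ Aᶜ, hO.inter hA.isOpen_compl, ?_⟩
    ext t
    have := Set.ext_iff.1 h t
    simp only [mem_inter_iff, mem_union, mem_compl_iff, mem_singleton_iff] at *
    grind

/-- A closed set contained in a D-subspace has a closed discrete kernel for every open
neighborhood assignment. -/
theorem IsDSpace.exists_kernel_of_isClosed {X : Type*} [TopologicalSpace X] {Z F : Set X}
    (hZ : IsDSpace ↥Z) (hF : IsClosed F) (hFZ : F ⊆ Z) (U : X → Set X)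
    (hU : ∀ x, IsOpen (U x)) (hxU : ∀ x, x ∈ U x) :
    ∃ D ⊆ F, IsClosed D ∧ DiscreteTopology ↥D ∧ F ⊆ ⋃ d ∈ D, U d := by
  classical
  obtain ⟨D, hDc, hDd, hD⟩ := hZ
    (fun z ↦ if z.1 ∈ F then Subtype.val ⁻¹' U z else Subtype.val ⁻¹' Fᶜ)
    (fun z ↦ by
      split_ifs
      · exact (hU z).preimage continuous_subtype_val
      · exact hF.isOpen_compl.preimage continuous_subtype_val)
    (fun z ↦ by
      split_ifs with h
      · exact hxU z
      · exact h)
  obtain ⟨C, hC, rfl⟩ := isClosed_induced_iff.1 hDc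
  refine ⟨C ∩ F, inter_subset_right, hC.inter hF, ?_, fun x hx ↦ ?_⟩
  · rw [discreteTopology_subtype_iff'] at *
    rintro x ⟨hxC, hxF⟩
    obtain ⟨O, hO, h⟩ := hDd ⟨x, hFZ hxF⟩ hxC
    obtain ⟨O, hO', rfl⟩ := isOpen_induced_iff.1 hO
    refine ⟨O, hO', ?_⟩
    ext t
    simp only [Set.ext_iff, mem_inter_iff, mem_preimage, mem_singleton_iff, Subtype.forall,
      Subtype.mk.injEq] at *
    grind
  · have := hD.ge (mem_univ (⟨x, hFZ hx⟩ : Z))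
    simp only [mem_iUnion] at this ⊢
    obtain ⟨d, hdC, hd⟩ := this
    split_ifs at hd with hdF
    · exact ⟨d, ⟨hdC, hdF⟩, hd⟩
    · exact absurd hx hd

/-- If `X = Y ∪ Z` where `Y` is closed and discrete in `X` and the subspace `Z`
is a D-space, then `X` is a D-space. -/
theorem stmt0 {X : Type*} [TopologicalSpace X] {Y Z : Set X}
    (hYZ : Y ∪ Z = Set.univ) (hYc : IsClosed Y) (hYd : DiscreteTopology ↥Y)
    (hZ : IsDSpace ↥Z) : IsDSpace X := by
  intro U hU hxU
  have hYV : Y ⊆ ⋃ y ∈ Y, U y := fun y hy ↦ mem_biUnion hy (hxU y)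
  have hV : IsOpen (⋃ y ∈ Y, U y) := isOpen_biUnion fun y _ ↦ hU y
  have hVZ : (⋃ y ∈ Y, U y)ᶜ ⊆ Z := fun x hx ↦
    (hYZ.ge (mem_univ x)).resolve_left fun hxY ↦ hx (hYV hxY)
  obtain ⟨D, hDF, hDc, hDd, hD⟩ :=
    hZ.exists_kernel_of_isClosed hV.isClosed_compl hVZ U hU hxU
  refine ⟨Y ∪ D, hYc.union hDc,
    discreteTopology_union_of_isClosed_of_disjoint hYc hDc hYd hDd
      (Set.disjoint_left.2 fun x hxY hxD ↦ hDF hxD (hYV hxY)), ?_⟩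
  rw [biUnion_union, eq_univ_iff_forall]
  intro x
  by_cases hx : x ∈ ⋃ y ∈ Y, U y
  · exact Or.inl hx
  · exact Or.inr (hD hx)
end

section
/- There exists a T₂ (Hausdorff), locally countable topological space X of cardinality ℵ₁ such that X is a D-space but X does not satisfy (*); in fact one may take X so that the set A = ω₁ × {0} ⊆ X has no complete accumulation point while every infinite subset of A has an accumulation point in X (so no uncountable subset of A is closed discrete in X). -/
open Set Cardinal Topology Filter

/-- `x` is a *complete accumulation point* of `A`: every open neighborhood of
`x` meets `A` in a set of full cardinality `|A|`. -/
def IsCompleteAccPt {X : Type*} [TopologicalSpace X] (x : X) (A : Set X) : Prop :=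
  ∀ U : Set X, IsOpen U → x ∈ U → #↥(U ∩ A) = #↥A

/-- `X` satisfies `(*)`: for every regular uncountable `κ` and every `A ⊆ X` of
cardinality `κ`, either `A` has a complete accumulation point or `A` has a
subset of cardinality `κ` which is closed and discrete in `X`. -/
def SatisfiesStar (X : Type*) [TopologicalSpace X] : Prop :=
  ∀ κ : Cardinal, κ.IsRegular → Cardinal.aleph0 < κ → ∀ A : Set X, #↥A = κ →
    (∃ x : X, IsCompleteAccPt x A) ∨
      ∃ B : Set X, B ⊆ A ∧ #↥B = κ ∧ IsClosed B ∧ DiscreteTopology ↥B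

/-- `X` is *locally countable*: every point has a countable neighborhood. -/
def LocallyCountable (X : Type*) [TopologicalSpace X] : Prop :=
  ∀ x : X, ∃ U ∈ nhds x, U.Countable

/-- A space is a D-space if it has a closed discrete subset (stated as the absence of accumulation
points) whose complement consists of isolated points. -/
theorem IsDSpace.of_isOpen_singleton {X : Type*} [TopologicalSpace X] {L : Set X}
    (hL : ∀ x, Lᶜ ∈ 𝓝[≠] x) (hiso : ∀ x ∉ L, IsOpen ({x} : Set X)) : IsDSpace X := by
  intro U hUo hUm
  have hD : ∀ x, Disjoint (𝓝[≠] x) (𝓟 (L ∪ (⋃ l ∈ L, U l)ᶜ)) := by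
    intro x
    by_cases hx : x ∈ L
    · rw [disjoint_principal_right]
      filter_upwards [hL x, mem_nhdsWithin_of_mem_nhds ((hUo x).mem_nhds (hUm x))] with y hyL hyU
      rintro (hy | hy)
      · exact hyL hy
      · exact hy (mem_biUnion hx hyU)
    · rw [(isOpen_singleton_iff_punctured_nhds x).1 (hiso x hx)]
      exact disjoint_bot_left
  obtain ⟨hc, hd⟩ := isClosed_and_discrete_iff.2 hD
  refine ⟨_, hc, isDiscrete_iff_discreteTopology.1 hd, eq_univ_of_forall fun x ↦ ?_⟩
  by_cases hx : x ∈ ⋃ l ∈ L, U l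
  · obtain ⟨l, hl, hxl⟩ := mem_iUnion₂.1 hx
    exact mem_biUnion (Or.inl hl) hxl
  · exact mem_biUnion (Or.inr hx) (hUm x)

/-- Two copies of a linear order `W`: the points `inl a` are isolated, and the neighborhoods of
`inr a` contain all `inl b` with `b < a` sufficiently close to `a`. -/
def LeftLimitSpace (W : Type*) := W ⊕ W

namespace LeftLimitSpace

variable {W : Type*}

/-- The isolated points of `LeftLimitSpace W`. -/
def inl (a : W) : LeftLimitSpace W := Sum.inl a

/-- The limit points of `LeftLimitSpace W`. -/
def inr (a : W) : LeftLimitSpace W := Sum.inr a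

theorem inl_injective : Function.Injective (inl : W → LeftLimitSpace W) := Sum.inl_injective

theorem disjoint_insert_inr {a b : W} {s t : Set W} (hab : a ≠ b) (hst : Disjoint s t) :
    Disjoint (insert (inr a) (inl '' s)) (insert (inr b) (inl '' t)) := by
  rw [Set.disjoint_left] at hst ⊢
  rintro _ (rfl | ⟨c, hc, rfl⟩) (h | ⟨d, hd, h⟩)
  · exact hab (Sum.inr_injective h)
  · exact Sum.inl_ne_inr h
  · exact Sum.inl_ne_inr h
  · exact hst hc (inl_injective h ▸ hd)

variable [LinearOrder W]

/-- The filter of left neighborhoods of `a`, excluding `a`, in the order topology. -/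
def leftNhds (a : W) : Filter W := @nhdsWithin W (Preorder.topology W) a (Iio a)

theorem Iio_mem_leftNhds (a : W) : Iio a ∈ leftNhds a :=
  @self_mem_nhdsWithin W (Preorder.topology W) a (Iio a)

theorem Ioi_mem_leftNhds {a b : W} (h : b < a) : Ioi b ∈ leftNhds a := by
  let _ : TopologicalSpace W := Preorder.topology W
  have : OrderTopology W := ⟨rfl⟩
  exact mem_nhdsWithin_of_mem_nhds (Ioi_mem_nhds h)

theorem exists_Ioo_subset {a c : W} (hc : c < a) {s : Set W} (hs : s ∈ leftNhds a) :
    ∃ b < a, Ioo b a ⊆ s := by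
  let _ : TopologicalSpace W := Preorder.topology W
  have : OrderTopology W := ⟨rfl⟩
  exact (nhdsLT_basis_of_exists_lt ⟨c, hc⟩).mem_iff.1 hs

instance : TopologicalSpace (LeftLimitSpace W) where
  IsOpen U := ∀ a, inr a ∈ U → inl ⁻¹' U ∈ leftNhds a
  isOpen_univ _ _ := univ_mem
  isOpen_inter _ _ hs ht a ha := inter_mem (hs a ha.1) (ht a ha.2)
  isOpen_sUnion S hS a := by
    rintro ⟨s, hs, ha⟩
    exact mem_of_superset (hS s hs a ha) fun b hb ↦ ⟨s, hs, hb⟩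

theorem isOpen_def {U : Set (LeftLimitSpace W)} :
    IsOpen U ↔ ∀ a, inr a ∈ U → inl ⁻¹' U ∈ leftNhds a := Iff.rfl

theorem isOpen_image_inl (s : Set W) : IsOpen (inl '' s) := by
  rintro a ⟨b, -, hb⟩
  exact absurd hb Sum.inl_ne_inr

theorem isOpen_singleton_inl (a : W) : IsOpen {inl a} := by
  simpa using isOpen_image_inl {a}

theorem isOpen_insert_inr {a : W} {s : Set W} (hs : s ∈ leftNhds a) :
    IsOpen (insert (inr a) (inl '' s)) := by
  rintro b (hb | ⟨c, -, hc⟩)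
  · obtain rfl : b = a := Sum.inr_injective hb
    exact mem_of_superset hs fun c hc ↦ Or.inr ⟨c, hc, rfl⟩
  · exact absurd hc Sum.inl_ne_inr

theorem disjoint_singleton_insert_inr (b a : W) :
    Disjoint {inl b} (insert (inr a) (inl '' (Iio a \ {b}))) := by
  rw [Set.disjoint_singleton_left]
  rintro (h | ⟨c, hc, h⟩)
  · exact Sum.inl_ne_inr h
  · exact hc.2 (inl_injective h)

theorem Iio_diff_mem_leftNhds (a b : W) : Iio a \ {b} ∈ leftNhds a := by
  rcases lt_or_ge b a with h | h
  · filter_upwards [Iio_mem_leftNhds a, Ioi_mem_leftNhds h] with c hca hbc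
    exact ⟨hca, ne_of_gt hbc⟩
  · filter_upwards [Iio_mem_leftNhds a] with c hca
    exact ⟨hca, ne_of_lt (lt_of_lt_of_le hca h)⟩

theorem separatedNhds_inr {a b : W} (h : a < b) :
    ∃ u v : Set (LeftLimitSpace W), IsOpen u ∧ IsOpen v ∧ inr a ∈ u ∧ inr b ∈ v ∧ Disjoint u v :=
  ⟨_, _, isOpen_insert_inr (Iio_mem_leftNhds a), isOpen_insert_inr (Ioi_mem_leftNhds h),
    mem_insert _ _, mem_insert _ _,
    disjoint_insert_inr h.ne (Set.disjoint_left.2 fun _ hc hd ↦ lt_asymm hc hd)⟩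

instance : T2Space (LeftLimitSpace W) where
  t2 := by
    rintro (a | a) (b | b) hab
    · exact ⟨{inl a}, {inl b}, isOpen_singleton_inl a, isOpen_singleton_inl b, rfl, rfl,
        Set.disjoint_singleton.2 hab⟩
    · exact ⟨_, _, isOpen_singleton_inl a, isOpen_insert_inr (Iio_diff_mem_leftNhds b a), rfl,
        mem_insert _ _, disjoint_singleton_insert_inr a b⟩
    · exact ⟨_, _, isOpen_insert_inr (Iio_diff_mem_leftNhds a b), isOpen_singleton_inl b,
        mem_insert _ _, rfl, (disjoint_singleton_insert_inr b a).symm⟩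
    · have hne : a ≠ b := fun h ↦ hab (congrArg _ h)
      rcases hne.lt_or_gt with h | h
      · exact separatedNhds_inr h
      · obtain ⟨u, v, hu, hv, hbu, hav, huv⟩ := separatedNhds_inr h
        exact ⟨v, u, hv, hu, hav, hbu, huv.symm⟩

theorem locallyCountable (hW : ∀ a : W, (Iio a).Countable) :
    LocallyCountable (LeftLimitSpace W) := by
  rintro (a | a)
  · exact ⟨_, (isOpen_singleton_inl a).mem_nhds rfl, countable_singleton _⟩
  · exact ⟨_, (isOpen_insert_inr (Iio_mem_leftNhds a)).mem_nhds (mem_insert _ _),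
      ((hW a).image _).insert _⟩

theorem isDSpace : IsDSpace (LeftLimitSpace W) := by
  refine IsDSpace.of_isOpen_singleton (L := range inr) ?_ ?_
  · rintro (a | a)
    · change (range inr)ᶜ ∈ 𝓝[≠] (inl a)
      rw [(isOpen_singleton_iff_punctured_nhds _).1 (isOpen_singleton_inl a)]
      exact mem_bot
    · filter_upwards [self_mem_nhdsWithin, mem_nhdsWithin_of_mem_nhds
        ((isOpen_insert_inr (Iio_mem_leftNhds a)).mem_nhds (mem_insert _ _))]
      rintro _ hne (rfl | ⟨c, -, rfl⟩)
      · exact absurd rfl hne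
      · rintro ⟨d, hd⟩
        exact Sum.inr_ne_inl hd
  · rintro (a | a) ha
    · exact isOpen_singleton_inl a
    · exact absurd ⟨a, rfl⟩ ha

/-- If all proper initial segments of `W` are countable but `W` is not, every infinite set of
isolated points has an accumulation point. -/
theorem exists_accPt [WellFoundedLT W] [Uncountable W] (hW : ∀ a : W, (Iio a).Countable)
    {B : Set (LeftLimitSpace W)} (hB : B ⊆ range inl) (hBinf : B.Infinite) :
    ∃ x, AccPt x (𝓟 B) := by
  have hpre : (inl ⁻¹' B).Infinite := hBinf.preimage hB
  obtain ⟨C, hCB, hCinf, hCc⟩ : ∃ C ⊆ inl ⁻¹' B, C.Infinite ∧ C.Countable := by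
    have := hpre.to_subtype
    refine ⟨range fun n ↦ (Infinite.natEmbedding (inl ⁻¹' B) n : W), ?_, ?_, countable_range _⟩
    · rintro _ ⟨n, rfl⟩
      exact Subtype.coe_prop _
    · exact infinite_range_of_injective
        (Subtype.val_injective.comp (Infinite.natEmbedding (inl ⁻¹' B)).injective)
  obtain ⟨u, hu⟩ : ∃ u, (Iio u ∩ C).Infinite := by
    have hcount : (⋃ c ∈ C, Iic c).Countable := hCc.biUnion fun c _ ↦ by
      rw [← Iio_insert]
      exact (hW c).insert c
    obtain ⟨u, hu⟩ : ∃ u, u ∉ ⋃ c ∈ C, Iic c := by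
      by_contra! h
      exact not_countable_univ (hcount.mono fun x _ ↦ h x)
    refine ⟨u, hCinf.mono fun c hc ↦ ⟨?_, hc⟩⟩
    exact not_le.1 fun h ↦ hu (mem_biUnion hc h)
  obtain ⟨a, ha, hmin⟩ := wellFounded_lt.has_min {u : W | (Iio u ∩ C).Infinite} ⟨u, hu⟩
  obtain ⟨c₀, hc₀, -⟩ := ha.nonempty
  refine ⟨inr a, accPt_iff_nhds.2 fun U hU ↦ ?_⟩
  obtain ⟨V, hVU, hVo, haV⟩ := mem_nhds_iff.1 hU
  obtain ⟨b, hba, hb⟩ := exists_Ioo_subset hc₀ (isOpen_def.1 hVo a haV)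
  have hfin : (Iic b ∩ C).Finite := by
    have h : (Iio b ∩ C).Finite := not_infinite.1 fun h ↦ hmin b h hba
    refine (h.insert b).subset ?_
    rintro c ⟨hcb, hcC⟩
    rcases hcb.eq_or_lt with rfl | hlt
    · exact mem_insert _ _
    · exact Or.inr ⟨hlt, hcC⟩
  obtain ⟨c, ⟨hca, hcC⟩, hcb⟩ := (ha.sdiff hfin).nonempty
  refine ⟨inl c, ⟨hVU (hb ⟨?_, hca⟩), hCB hcC⟩, Sum.inl_ne_inr⟩
  exact not_le.1 fun h ↦ hcb ⟨h, hcC⟩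

end LeftLimitSpace

/-- In a locally countable space, an uncountable set has no complete accumulation point. -/
theorem LocallyCountable.not_isCompleteAccPt {X : Type*} [TopologicalSpace X]
    (hX : LocallyCountable X) {A : Set X} (hA : ¬A.Countable) (x : X) :
    ¬IsCompleteAccPt x A := by
  intro h
  obtain ⟨U, hU, hUc⟩ := hX x
  obtain ⟨V, hVU, hVo, hxV⟩ := mem_nhds_iff.1 hU
  refine hA (le_aleph0_iff_set_countable.1 ?_)
  rw [← h V hVo hxV]
  exact le_aleph0_iff_set_countable.2 (hUc.mono (inter_subset_left.trans hVU))

/-- There is a Hausdorff, locally countable D-space `X` of cardinality `ℵ₁`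
which does not satisfy `(*)`; indeed `X` contains a set `A` of cardinality `ℵ₁`
with no complete accumulation point such that every infinite subset of `A` has
an accumulation point in `X`. -/
theorem stmt1 :
    ∃ (X : Type) (t : TopologicalSpace X),
      @T2Space X t ∧ @LocallyCountable X t ∧ #X = Cardinal.aleph 1 ∧
      @IsDSpace X t ∧ ¬@SatisfiesStar X t ∧
      ∃ A : Set X, #↥A = Cardinal.aleph 1 ∧
        (∀ x : X, ¬@IsCompleteAccPt X t x A) ∧
        ∀ B : Set X, B ⊆ A → B.Infinite → ∃ x : X, @AccPt X t x (Filter.principal B) := by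
  have hcard : #(aleph 1).ord.ToType = aleph 1 := mk_ord_toType _
  have hW : ∀ a : (aleph 1).ord.ToType, (Iio a).Countable := fun a ↦ by
    have h : #(Iio a) < Order.succ ℵ₀ :=
      (mk_Iio_lt a (by simp)).trans_eq (hcard.trans succ_aleph0.symm)
    exact le_aleph0_iff_set_countable.1 (Order.lt_succ_iff.1 h)
  have : Uncountable (aleph 1).ord.ToType := by
    rw [← aleph0_lt_mk_iff, hcard]
    exact aleph0_lt_aleph_one
  have hA : #(range (LeftLimitSpace.inl : (aleph 1).ord.ToType → _)) = aleph 1 :=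
    (mk_range_eq _ LeftLimitSpace.inl_injective).trans hcard
  have hcomplete := (LeftLimitSpace.locallyCountable hW).not_isCompleteAccPt
    (A := range LeftLimitSpace.inl) fun h ↦
      (le_aleph0_iff_set_countable.2 h).not_gt (aleph0_lt_aleph_one.trans_eq hA.symm)
  refine ⟨LeftLimitSpace (aleph 1).ord.ToType, inferInstance, inferInstance,
    LeftLimitSpace.locallyCountable hW, ?_, LeftLimitSpace.isDSpace, fun hstar ↦ ?_,
    range LeftLimitSpace.inl, hA, hcomplete, fun B ↦ LeftLimitSpace.exists_accPt hW⟩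
  · exact (mk_sum _ _).trans (by simp)
  · obtain ⟨x, hx⟩ | ⟨B, hBA, hB, hBc, hBd⟩ :=
      hstar _ isRegular_aleph_one aleph0_lt_aleph_one _ hA
    · exact hcomplete x hx
    · have hinf : B.Infinite := infinite_coe_iff.1 (infinite_iff.2 ((aleph0_le_aleph 1).trans_eq hB.symm))
      obtain ⟨x, hx⟩ := LeftLimitSpace.exists_accPt hW hBA hinf
      exact hx.ne (isClosed_and_discrete_iff.1 ⟨hBc, isDiscrete_iff_discreteTopology.2 hBd⟩ x).eq_bot
end

section
/- Let X be a first-countable Hausdorff space and F ⊆ X a subspace for which there exists a perfect surjection f : F → ω₁ (ω₁ with the order topology). Then F is closed in X. -/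
open Set Cardinal Topology Filter

/-- `f` is a *perfect map*: continuous, closed, with all fibers compact. -/
def PerfectMap {A B : Type*} [TopologicalSpace A] [TopologicalSpace B] (f : A → B) : Prop :=
  Continuous f ∧ IsClosedMap f ∧ ∀ b : B, IsCompact (f ⁻¹' {b})

/-- In a well-order isomorphic to `ω₁`, every sequence is bounded above. -/
theorem exists_forall_le_of_orderIso_omega_one {W : Type*} [LinearOrder W]
    (e : W ≃o ↥(Set.Iio (Cardinal.aleph 1).ord)) (u : ℕ → W) : ∃ a, ∀ n, u n ≤ a := by
  have h : ⨆ n, (e (u n)).1 < (Cardinal.aleph 1).ord := by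
    have h' := fun n => (e (u n)).2
    simp only [Cardinal.ord_aleph, mem_Iio] at h' ⊢
    exact Ordinal.iSup_lt_omega_one h'
  refine ⟨e.symm ⟨_, h⟩, fun n => ?_⟩
  rw [OrderIso.le_symm_apply]
  exact Ordinal.le_iSup (fun n => (e (u n)).1) n

theorem isCompact_Iic_of_wellFoundedLT {W : Type*} [LinearOrder W] [WellFoundedLT W]
    [TopologicalSpace W] [OrderTopology W] (a : W) : IsCompact (Set.Iic a) := by
  have : Nonempty W := ⟨a⟩
  let := WellFoundedLT.toOrderBot W
  let := WellFoundedLT.conditionallyCompleteLinearOrderBot W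
  rw [← Set.Icc_bot]
  exact isCompact_Icc

/-- If `X` is first countable Hausdorff and a subspace `F ⊆ X` admits a perfect
surjection onto `ω₁` (with the order topology), then `F` is closed in `X`. -/
theorem stmt4 {X : Type*} [TopologicalSpace X] [T2Space X] [FirstCountableTopology X]
    {F : Set X} {W : Type*} [LinearOrder W] [TopologicalSpace W] [OrderTopology W]
    (hW : Nonempty (W ≃o ↥(Set.Iio (Cardinal.aleph 1).ord)))
    (f : ↥F → W) (hf : Function.Surjective f) (hp : PerfectMap f) :
    IsClosed F := by
  obtain ⟨e⟩ := hW
  have : WellFoundedLT W := e.toOrderEmbedding.wellFoundedLT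
  have hproper : IsProperMap f :=
    isProperMap_iff_isClosedMap_and_compact_fibers.2 hp
  refine IsSeqClosed.isClosed fun x p hx hxp => ?_
  obtain ⟨a, ha⟩ := exists_forall_le_of_orderIso_omega_one e fun n => f ⟨x n, hx n⟩
  have hK : IsCompact (Subtype.val '' (f ⁻¹' Set.Iic a)) :=
    (hproper.isCompact_preimage (isCompact_Iic_of_wellFoundedLT a)).image continuous_subtype_val
  obtain ⟨y, -, rfl⟩ := hK.isClosed.mem_of_tendsto hxp
    (Eventually.of_forall fun n => ⟨⟨x n, hx n⟩, ha n, rfl⟩)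
  exact y.2
end

section
/- Assume Martin's Axiom. Then for every locally countable, locally compact Hausdorff space X of cardinality strictly less than 2^ℵ⁰, the following are equivalent: (0) X is the union of countably many closed discrete subspaces; (1) X is a D-space; (2) X is linearly D; (3) X satisfies (*). -/
open Set Cardinal Topology Filter

/-- `X` is *linearly D*: every open neighborhood assignment whose range is
linearly ordered (monotone) by inclusion has a closed discrete kernel. -/
def IsLinearlyDSpace (X : Type*) [TopologicalSpace X] : Prop :=
  ∀ U : X → Set X, (∀ x, IsOpen (U x)) → (∀ x, x ∈ U x) →
    (∀ x y, U x ⊆ U y ∨ U y ⊆ U x) →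
    ∃ D : Set X, IsClosed D ∧ DiscreteTopology ↥D ∧ ⋃ d ∈ D, U d = Set.univ

/-- A partial order is *ccc*: every antichain (no two distinct elements have a
common lower bound) is countable. -/
def CCCOrder (P : Type) [PartialOrder P] : Prop :=
  ∀ A : Set P, (∀ p ∈ A, ∀ q ∈ A, p ≠ q → ¬∃ r, r ≤ p ∧ r ≤ q) → A.Countable

/-- *Martin's Axiom*: for every nonempty ccc partial order `P` and every family
`𝔻` of fewer than `2^ℵ₀` dense subsets of `P`, there is a filter on `P`
meeting every member of `𝔻`. -/
def MartinsAxiom : Prop :=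
  ∀ (P : Type) [inst : PartialOrder P], Nonempty P → CCCOrder P →
    ∀ 𝔻 : Set (Set P), (∀ D ∈ 𝔻, ∀ p : P, ∃ q ∈ D, q ≤ p) →
      #↥𝔻 < 2 ^ Cardinal.aleph0 →
      ∃ G : Set P, G.Nonempty ∧ (∀ p ∈ G, ∀ q, p ≤ q → q ∈ G) ∧
        (∀ p ∈ G, ∀ q ∈ G, ∃ r ∈ G, r ≤ p ∧ r ≤ q) ∧ ∀ D ∈ 𝔻, (G ∩ D).Nonempty

theorem Set.Infinite.exists_countable_infinite_subset {α : Type*} {s : Set α} (hs : s.Infinite) :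
    ∃ t ⊆ s, t.Infinite ∧ t.Countable :=
  ⟨range fun n => (hs.natEmbedding s n : α), range_subset_iff.2 fun n => (hs.natEmbedding s n).2,
    infinite_range_of_injective (Subtype.val_injective.comp (hs.natEmbedding s).injective),
    countable_range _⟩

/-- In a `T1` space the closed discrete sets are the locally finite ones. -/
theorem isClosed_and_discreteTopology_iff {X : Type*} [TopologicalSpace X] [T1Space X]
    {D : Set X} :
    IsClosed D ∧ DiscreteTopology ↥D ↔ ∀ x, ∃ U ∈ 𝓝 x, (U ∩ D).Finite := by
  rw [← isDiscrete_iff_discreteTopology, isClosed_and_discrete_iff]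
  refine forall_congr' fun x => ?_
  rw [disjoint_principal_right, mem_nhdsWithin_iff_exists_mem_nhds_inter]
  constructor
  · rintro ⟨U, hU, h⟩
    refine ⟨U, hU, (finite_singleton x).subset fun y hy => ?_⟩
    by_contra hne
    exact h ⟨hy.1, hne⟩ hy.2
  · rintro ⟨U, hU, h⟩
    have hF : ((U ∩ D) \ {x}).Finite := h.subset sdiff_subset
    refine ⟨U ∩ ((U ∩ D) \ {x})ᶜ,
      inter_mem hU (hF.isClosed.isOpen_compl.mem_nhds fun hx => hx.2 rfl), ?_⟩
    rintro y ⟨⟨hyU, hy⟩, hyx⟩ hyD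
    exact hy ⟨⟨hyU, hyD⟩, hyx⟩

theorem LocallyCountable.countable_of_isCompact {X : Type*} [TopologicalSpace X]
    (h : LocallyCountable X) {K : Set X} (hK : IsCompact K) : K.Countable := by
  choose U hU hUc using h
  obtain ⟨t, -, ht⟩ := hK.elim_nhds_subcover U fun x _ => hU x
  exact (t.countable_toSet.biUnion fun x _ => hUc x).mono ht

/-- In a locally countable space every point in the closure of `Q` is in the closure of a
countable subset of `Q`. -/
theorem LocallyCountable.mem_closure_countable {X : Type*} [TopologicalSpace X]
    (h : LocallyCountable X) {Q : Set X} {x : X} (hx : x ∈ closure Q) :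
    ∃ C ⊆ Q, C.Countable ∧ x ∈ closure C := by
  obtain ⟨U, hU, hUc⟩ := h x
  refine ⟨U ∩ Q, inter_subset_right, hUc.mono inter_subset_left, ?_⟩
  rw [mem_closure_iff_nhds] at hx ⊢
  intro t ht
  obtain ⟨y, ⟨hyt, hyU⟩, hyQ⟩ := hx (t ∩ U) (inter_mem ht hU)
  exact ⟨y, hyt, hyU, hyQ⟩

/-- The relatively compact subsets of `X` are those all of whose countable subsets are relatively
compact; equivalently, the one-point compactification of `X` is countably tight at infinity. -/
def TightAtInfty (X : Type*) [TopologicalSpace X] : Prop :=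
  ∀ Q : Set X, (∀ C ⊆ Q, C.Countable → ∃ K, IsCompact K ∧ C ⊆ K) → ∃ K, IsCompact K ∧ Q ⊆ K

theorem IsDSpace.isLinearlyDSpace {X : Type*} [TopologicalSpace X] (h : IsDSpace X) :
    IsLinearlyDSpace X :=
  fun U ho hm _ => h U ho hm

theorem isDSpace_of_iUnion_closedDiscrete {X : Type*} [TopologicalSpace X] [T1Space X]
    {D : ℕ → Set X} (hD : ∀ n, IsClosed (D n) ∧ DiscreteTopology ↥(D n))
    (hcov : ⋃ n, D n = Set.univ) : IsDSpace X := by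
  intro U hUo hUm
  let W : ℕ → Set X := Nat.rec ∅ fun n W => W ∪ ⋃ d ∈ D n \ W, U d
  have hW : ∀ n, W (n + 1) = W n ∪ ⋃ d ∈ D n \ W n, U d := fun n => rfl
  have hWo : ∀ n, IsOpen (W n) := by
    intro n
    induction n with
    | zero => exact isOpen_empty
    | succ n ih =>
      rw [hW]
      exact ih.union (isOpen_biUnion fun d _ => hUo d)
  have hWmono : Monotone W := monotone_nat_of_le_succ fun n => by
    rw [hW]; exact subset_union_left
  have hDW : ∀ n, D n ⊆ W (n + 1) := by
    intro n x hx
    rw [hW]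
    rcases em (x ∈ W n) with hxW | hxW
    · exact Or.inl hxW
    · exact Or.inr (mem_biUnion (show x ∈ D n \ W n from ⟨hx, hxW⟩) (hUm x))
  have hWE : ∀ n, W n ⊆ ⋃ d ∈ ⋃ m, D m \ W m, U d := by
    intro n
    induction n with
    | zero => exact empty_subset _
    | succ n ih =>
      rw [hW]
      exact union_subset ih (biUnion_subset_biUnion_left (subset_iUnion (fun m => D m \ W m) n))
  refine ⟨⋃ n, D n \ W n, ?_⟩
  rw [← and_assoc, isClosed_and_discreteTopology_iff]
  have hmem : ∀ x, ∃ n, x ∈ D n := fun x => by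
    have := mem_univ x
    rwa [← hcov, mem_iUnion] at this
  refine ⟨fun x => ?_, ?_⟩
  · obtain ⟨n, hn⟩ := hmem x
    choose V hV hVf using fun m => isClosed_and_discreteTopology_iff.1 (hD m) x
    refine ⟨W (n + 1) ∩ ⋂ m ∈ Finset.range (n + 1), V m,
      inter_mem ((hWo (n + 1)).mem_nhds (hDW n hn)) ((biInter_finset_mem _).2 fun m _ => hV m), ?_⟩
    refine ((Finset.range (n + 1)).finite_toSet.biUnion fun m _ => hVf m).subset ?_
    rintro y ⟨⟨hyW, hyV⟩, hy⟩
    obtain ⟨m, hyD, hym⟩ := mem_iUnion.1 hy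
    have hm : m < n + 1 := by
      by_contra hlt
      exact hym (hWmono (not_lt.1 hlt) hyW)
    have hm' := Finset.mem_range.2 hm
    exact mem_biUnion (Finset.mem_coe.2 hm') ⟨mem_iInter₂.1 hyV m hm', hyD⟩
  · refine eq_univ_of_forall fun x => ?_
    obtain ⟨n, hn⟩ := hmem x
    exact hWE (n + 1) (hDW n hn)

theorem satisfiesStar_of_iUnion_closedDiscrete {X : Type*} [TopologicalSpace X] [T1Space X]
    {D : ℕ → Set X} (hD : ∀ n, IsClosed (D n) ∧ DiscreteTopology ↥(D n))
    (hcov : ⋃ n, D n = Set.univ) : SatisfiesStar X := by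
  intro κ hκ hκ' A hA
  right
  by_contra! hcon
  have hlt : ∀ n, #↥(A ∩ D n) < κ := by
    intro n
    refine lt_of_le_of_ne (hA ▸ mk_le_mk_of_subset inter_subset_left) fun heq => ?_
    have hcd : IsClosed (A ∩ D n) ∧ DiscreteTopology ↥(A ∩ D n) := by
      rw [isClosed_and_discreteTopology_iff]
      intro x
      obtain ⟨U, hU, hf⟩ := isClosed_and_discreteTopology_iff.1 (hD n) x
      exact ⟨U, hU, hf.subset (inter_subset_inter_right _ inter_subset_right)⟩
    exact hcon _ inter_subset_left heq hcd.1 hcd.2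
  have hAU : A = ⋃ n : ULift ℕ, A ∩ D n.down := by
    rw [← inter_iUnion]
    exact (by rw [Equiv.ulift.surjective.iUnion_comp D, hcov, inter_univ] :
      A = A ∩ ⋃ n : ULift ℕ, D (Equiv.ulift n))
  have := (card_iUnion_lt_iff_forall_of_isRegular (t := fun n : ULift ℕ => A ∩ D n.down) hκ
    (by simpa using hκ')).2 fun n => hlt n.down
  rw [← hAU, hA] at this
  exact this.false

theorem exists_mk_eq_aleph_one {X : Type*} [TopologicalSpace X] {Q : Set X}
    (hQ : ∀ C ⊆ Q, C.Countable → ∃ K, IsCompact K ∧ C ⊆ K)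
    (hQ' : ¬∃ K, IsCompact K ∧ Q ⊆ K) : ∃ A ⊆ Q, #↥A = ℵ₁ := by
  apply le_mk_iff_exists_subset.1
  by_contra hlt
  rw [not_le, ← succ_aleph0, Order.lt_succ_iff, le_aleph0_iff_set_countable] at hlt
  exact hQ' (hQ Q Subset.rfl hlt)

theorem SatisfiesStar.tightAtInfty {X : Type*} [TopologicalSpace X]
    (h : SatisfiesStar X) (hc : LocallyCountable X) : TightAtInfty X := by
  intro Q hQ
  by_contra hQ'
  obtain ⟨A, hAQ, hA⟩ := exists_mk_eq_aleph_one hQ hQ'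
  rcases h ℵ₁ isRegular_aleph_one aleph0_lt_aleph_one A hA with ⟨x, hx⟩ | ⟨B, hBA, hB, hBc, hBd⟩
  · obtain ⟨U, hU, hUc⟩ := hc x
    have h1 := hx (interior U) isOpen_interior (mem_interior_iff_mem_nhds.2 hU)
    have h2 : #↥(interior U ∩ A) ≤ ℵ₀ :=
      le_aleph0_iff_set_countable.2 (hUc.mono (inter_subset_left.trans interior_subset))
    rw [h1, hA] at h2
    exact h2.not_gt aleph0_lt_aleph_one
  · have hBinf : B.Infinite := by
      rw [← infinite_coe_iff, infinite_iff, hB]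
      exact aleph0_lt_aleph_one.le
    obtain ⟨C, hCB, hCi, hCc⟩ := hBinf.exists_countable_infinite_subset
    obtain ⟨K, hK, hCK⟩ := hQ C (hCB.trans (hBA.trans hAQ)) hCc
    exact hCi (((hK.inter_left hBc).finite
      ((isDiscrete_iff_discreteTopology.2 hBd).mono inter_subset_left)).subset
      (subset_inter hCB hCK))

theorem IsLinearlyDSpace.tightAtInfty {X : Type*} [TopologicalSpace X] [T2Space X]
    (h : IsLinearlyDSpace X) (hc : LocallyCountable X) : TightAtInfty X := by
  intro Q hQ
  by_contra hQ'
  obtain ⟨A, hAQ, hA⟩ := exists_mk_eq_aleph_one hQ hQ'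
  obtain ⟨e⟩ : Nonempty ((ℵ₁ : Cardinal).ord.ToType ≃ A) := by
    rw [← Cardinal.eq, mk_ord_toType, hA]
  set I := (ℵ₁ : Cardinal).ord.ToType
  have hI : ¬(univ : Set I).Countable := by
    rw [← le_aleph0_iff_set_countable, mk_univ, mk_ord_toType, not_le]
    exact aleph0_lt_aleph_one
  have hIic : ∀ i : I, (Iic i).Countable := by
    intro i
    rw [← Iio_insert]
    refine Countable.insert _ ?_
    rw [← le_aleph0_iff_set_countable, ← Order.lt_succ_iff, succ_aleph0]
    simpa [I] using mk_Iio_lt i (by simp [I])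
  have hbdd : ∀ S : Set I, S.Countable → ∃ b, ∀ s ∈ S, s < b := by
    intro S hS
    by_contra! hcon
    refine hI ((hS.biUnion fun s _ => hIic s).mono fun b _ => ?_)
    obtain ⟨s, hs, hbs⟩ := hcon b
    exact mem_biUnion hs hbs
  let a : I → X := fun i => e i
  have ha : Function.Injective a := Subtype.val_injective.comp e.injective
  let F : I → Set X := fun b => closure (a '' Ici b)
  have hFanti : Antitone F := fun b c hbc => closure_mono (image_mono (Ici_subset_Ici.2 hbc))
  have hFA : ∀ b, F b ⊆ closure A := fun b => closure_mono (by rintro _ ⟨i, -, rfl⟩; exact (e i).2)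
  have hex : ∀ x, ∃ b, x ∉ F b := by
    intro x
    obtain ⟨U, hU, hUc⟩ := hc x
    obtain ⟨b, hb⟩ := hbdd (a ⁻¹' U) (hUc.preimage_of_injOn ha.injOn)
    refine ⟨b, fun hx => ?_⟩
    obtain ⟨_, hyU, i, hi, rfl⟩ := mem_closure_iff_nhds.1 hx U hU
    exact (hb i hyU).not_ge hi
  have hne : Nonempty I := by
    by_contra hemp
    rw [not_nonempty_iff] at hemp
    exact hI (to_countable _)
  choose f hf hfmin using fun x => WellFounded.has_min (wellFounded_lt (α := I)) {b | x ∉ F b}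
    (hex x)
  obtain ⟨D, hDc, hDd, hDcov⟩ := h (fun x => (F (f x))ᶜ) (fun x => isClosed_closure.isOpen_compl)
    (fun x => hf x) fun x y => by
      rcases le_total (f x) (f y) with hxy | hxy
      · exact Or.inl (compl_subset_compl.2 (hFanti hxy))
      · exact Or.inr (compl_subset_compl.2 (hFanti hxy))
  have hinf : (D ∩ closure A).Infinite := by
    intro hfin
    obtain ⟨b, hb⟩ := hbdd _ (hfin.image f).countable
    have hab : a b ∈ ⋃ d ∈ D, (F (f d))ᶜ := hDcov ▸ mem_univ _
    obtain ⟨d, hdD, hd⟩ := mem_iUnion₂.1 hab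
    have hfd : f d ≤ b := by
      by_cases hdA : d ∈ closure A
      · exact (hb _ (mem_image_of_mem f ⟨hdD, hdA⟩)).le
      · exact not_lt.1 (hfmin d b fun hdb => hdA (hFA b hdb))
    exact hd (subset_closure (mem_image_of_mem a hfd))
  obtain ⟨E, hED, hEi, hEc⟩ := hinf.exists_countable_infinite_subset
  choose! C hCA hCc hC using fun d (hd : d ∈ closure A) => hc.mem_closure_countable hd
  have hEA : ∀ d ∈ E, d ∈ closure A := fun d hd => (hED hd).2
  obtain ⟨K, hK, hCK⟩ := hQ (⋃ d ∈ E, C d)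
    (iUnion₂_subset fun d hd => (hCA d (hEA d hd)).trans hAQ)
    (hEc.biUnion fun d hd => hCc d (hEA d hd))
  refine hEi (((hK.inter_left hDc).finite
      ((isDiscrete_iff_discreteTopology.2 hDd).mono inter_subset_left)).subset fun d hd => ?_)
  refine ⟨(hED hd).1, ?_⟩
  rw [← hK.isClosed.closure_eq]
  exact closure_mono ((subset_biUnion_of_mem hd).trans hCK) (hC d (hEA d hd))

/-- Tightness at infinity passes to finite powers: a family of `n`-tuples which is met by no
compact set has a countable subfamily which is met by no compact set. -/
theorem TightAtInfty.exists_countable {X : Type*} [TopologicalSpace X] [T2Space X]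
    [WeaklyLocallyCompactSpace X] (hX : TightAtInfty X) {ι : Type*} (n : ℕ) :
    ∀ (a : ι → Fin n → X) (A : Set ι),
      (∀ K, IsCompact K → ∃ i ∈ A, ∀ j, a i j ∉ K) →
      ∃ C ⊆ A, C.Countable ∧ ∀ K, IsCompact K → ∃ i ∈ C, ∀ j, a i j ∉ K := by
  induction n with
  | zero =>
    intro a A hA
    obtain ⟨i, hi, -⟩ := hA ∅ isCompact_empty
    exact ⟨{i}, singleton_subset_iff.2 hi, countable_singleton i,
      fun K _ => ⟨i, rfl, fun j => j.elim0⟩⟩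
  | succ n ih =>
    intro a A hA
    simp only [Fin.forall_fin_succ] at hA ⊢
    by_contra! hcon
    let Q : Set X := {q | ∃ C ⊆ A, C.Countable ∧
      ∀ W ∈ 𝓝 q, ∀ L, IsCompact L → ∃ i ∈ C, a i 0 ∈ W ∧ ∀ j : Fin n, a i j.succ ∉ L}
    have hQ : ∀ K, IsCompact K → ¬Q ⊆ K := by
      intro K hK hQK
      obtain ⟨K', hK', hKK'⟩ := exists_compact_superset hK
      obtain ⟨C, hCA, hCc, hC⟩ := ih (fun i j => a i j.succ) {i ∈ A | a i 0 ∉ K'} fun L hL => by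
        obtain ⟨i, hi, hi0, hij⟩ := hA (K' ∪ L) (hK'.union hL)
        exact ⟨i, ⟨hi, fun h => hi0 (Or.inl h)⟩, fun j h => hij j (Or.inr h)⟩
      obtain ⟨L₀, hL₀, hCL₀⟩ := hcon C (fun i hi => (hCA hi).1) hCc
      have hno : ∀ q ∈ L₀ \ interior K', ∃ W ∈ 𝓝 q, ∃ L, IsCompact L ∧
          ∀ i ∈ C, a i 0 ∈ W → ∃ j : Fin n, a i j.succ ∈ L := by
        intro q hq
        by_contra! hq'
        exact hq.2 (hKK' (hQK ⟨C, fun i hi => (hCA hi).1, hCc, hq'⟩))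
      choose! W hW L hL hWL using hno
      obtain ⟨t, ht, htcov⟩ := (hL₀.diff isOpen_interior).elim_nhds_subcover W hW
      obtain ⟨i, hi, hij⟩ := hC (L₀ ∪ ⋃ q ∈ t, L q)
        (hL₀.union (t.isCompact_biUnion fun q hq => hL q (ht q hq)))
      have hi0 : a i 0 ∈ L₀ := by
        by_contra h0
        obtain ⟨j, hj⟩ := hCL₀ i hi h0
        exact hij j (Or.inl hj)
      obtain ⟨q, hq, hiq⟩ := mem_iUnion₂.1
        (htcov ⟨hi0, fun h => (hCA hi).2 (interior_subset h)⟩)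
      obtain ⟨j, hj⟩ := hWL q (ht q hq) i hi hiq
      exact hij j (Or.inr (mem_biUnion hq hj))
    obtain ⟨S, hSQ, hSc, hS⟩ : ∃ S ⊆ Q, S.Countable ∧ ∀ K, IsCompact K → ¬S ⊆ K := by
      by_contra! h
      obtain ⟨K, hK, hQK⟩ := hX Q h
      exact hQ K hK hQK
    simp only [Q, subset_def, mem_ofPred_eq] at hSQ
    choose! C hCA hCc hC using hSQ
    obtain ⟨L, hL, hCL⟩ := hcon (⋃ q ∈ S, C q) (iUnion₂_subset hCA) (hSc.biUnion hCc)
    obtain ⟨q, hqS, hqL⟩ := not_subset.1 (hS L hL)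
    obtain ⟨i, hi, hi0, hij⟩ := hC q hqS Lᶜ (hL.isClosed.isOpen_compl.mem_nhds hqL) L hL
    obtain ⟨j, hj⟩ := hCL i (mem_biUnion hqS hi) hi0
    exact hij j hj

/-- A weak form of the `Δ`-system lemma for finite sets of bounded cardinality. -/
theorem exists_finset_root {ι α : Type*} [DecidableEq α] (s : ι → Finset α) (A : Set ι)
    (hA : ¬A.Countable) (N : ℕ) (hN : ∀ i ∈ A, (s i).card = N) :
    ∃ R : Finset α, ∃ B ⊆ A, ¬B.Countable ∧ (∀ i ∈ B, R ⊆ s i) ∧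
      ∀ x ∉ R, {i ∈ B | x ∈ s i}.Countable := by
  classical
  let P : ℕ → Prop := fun k => ∃ R : Finset α, R.card = k ∧ ¬{i ∈ A | R ⊆ s i}.Countable
  have hP0 : P 0 := ⟨∅, rfl, by simpa using hA⟩
  have hPN : ∀ k, P k → k ≤ N := by
    rintro k ⟨R, rfl, hR⟩
    obtain ⟨i, hi⟩ : {i ∈ A | R ⊆ s i}.Nonempty := by
      by_contra h
      exact hR (not_nonempty_iff_eq_empty.1 h ▸ countable_empty)
    exact hN i hi.1 ▸ Finset.card_le_card hi.2
  obtain ⟨R, hRk, hR⟩ : P (Nat.findGreatest P N) := Nat.findGreatest_spec (Nat.zero_le N) hP0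
  refine ⟨R, {i ∈ A | R ⊆ s i}, sep_subset _ _, hR, fun i hi => hi.2, fun x hx => ?_⟩
  by_contra hunc
  have hP : P (R.card + 1) := by
    refine ⟨insert x R, Finset.card_insert_of_notMem hx, fun h => hunc (h.mono ?_)⟩
    rintro i ⟨⟨hiA, hiR⟩, hix⟩
    exact ⟨hiA, Finset.insert_subset hix hiR⟩
  have := Nat.le_findGreatest (hPN _ hP) hP
  omega

/-- The forcing condition consists of a finite set `s` of pairs `(x, n)`, deciding that `x` belongs
to the `n`-th set of the generic family, and a finite set `F` of pairs `(y, n)`, promising that the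
`n`-th set receives no further elements from `V y`. -/
structure SplitCond {Z : Type} (V : Z → Set Z) where
  /-- The decided memberships. -/
  s : Finset (Z × ℕ)
  /-- The promises. -/
  F : Finset (Z × ℕ)

instance {Z : Type} (V : Z → Set Z) : PartialOrder (SplitCond V) where
  le q p := p.s ⊆ q.s ∧ p.F ⊆ q.F ∧ ∀ u ∈ q.s, u ∉ p.s → ∀ v ∈ p.F, u.2 = v.2 → u.1 ∉ V v.1
  le_refl p := ⟨Finset.Subset.refl _, Finset.Subset.refl _, fun u hu hu' => absurd hu hu'⟩
  le_trans r q p hrq hqp := by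
    refine ⟨hqp.1.trans hrq.1, hqp.2.1.trans hrq.2.1, fun u hu hup v hv huv => ?_⟩
    by_cases huq : u ∈ q.s
    · exact hqp.2.2 u huq hup v hv huv
    · exact hrq.2.2 u hu huq v (hqp.2.1 hv) huv
  le_antisymm := by
    rintro ⟨s, F⟩ ⟨s', F'⟩ h h'
    obtain rfl : s = s' := h'.1.antisymm h.1
    obtain rfl : F = F' := h'.2.1.antisymm h.2.1
    rfl

theorem SplitCond.le_def {Z : Type} {V : Z → Set Z} {q p : SplitCond V} :
    q ≤ p ↔ p.s ⊆ q.s ∧ p.F ⊆ q.F ∧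
      ∀ u ∈ q.s, u ∉ p.s → ∀ v ∈ p.F, u.2 = v.2 → u.1 ∉ V v.1 :=
  Iff.rfl

/-- If the forcing with `SplitCond V` is ccc, then Martin's Axiom splits `Z` into countably many
sets each of which has finite intersection with every `V y`. -/
theorem MartinsAxiom.exists_split (hMA : MartinsAxiom) {Z : Type} (hZ : #Z < 2 ^ ℵ₀)
    (V : Z → Set Z) (hV : CCCOrder (SplitCond V)) :
    ∃ D : ℕ → Set Z, ⋃ n, D n = Set.univ ∧ ∀ n y, (V y ∩ D n).Finite := by
  classical
  let E₁ : Z → Set (SplitCond V) := fun x => {p | ∃ n, (x, n) ∈ p.s}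
  let E₂ : Z × ℕ → Set (SplitCond V) := fun v => {p | v ∈ p.F}
  obtain ⟨G, -, -, hG, hGE⟩ := hMA (SplitCond V) ⟨⟨∅, ∅⟩⟩ hV (range E₁ ∪ range E₂) (by
      rintro _ (⟨x, rfl⟩ | ⟨v, rfl⟩) p
      · obtain ⟨n, hn⟩ := Infinite.exists_notMem_finset (p.F.image Prod.snd)
        refine ⟨⟨insert (x, n) p.s, p.F⟩, ⟨n, Finset.mem_insert_self _ _⟩,
          Finset.subset_insert _ _, Finset.Subset.refl _, fun u hu hu' v hv huv => ?_⟩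
        obtain rfl := (Finset.mem_insert.1 hu).resolve_right hu'
        exact absurd (Finset.mem_image.2 ⟨v, hv, huv.symm⟩) hn
      · exact ⟨⟨p.s, insert v p.F⟩, Finset.mem_insert_self _ _, Finset.Subset.refl _,
          Finset.subset_insert _ _, fun u hu hu' => absurd hu hu'⟩) (by
      have hc : ℵ₀ < (2 : Cardinal.{0}) ^ ℵ₀ := cantor _
      refine (mk_union_le _ _).trans_lt (add_lt_of_lt hc.le (mk_range_le.trans_lt hZ)
        (mk_range_le.trans_lt ?_))
      rw [mk_prod, lift_id, lift_id, mk_nat]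
      exact mul_lt_of_lt hc.le hZ hc)
  refine ⟨fun n => {x | ∃ p ∈ G, (x, n) ∈ p.s}, eq_univ_of_forall fun x => ?_, fun n y => ?_⟩
  · obtain ⟨p, hpG, n, hn⟩ := hGE _ (Or.inl ⟨x, rfl⟩)
    exact mem_iUnion.2 ⟨n, p, hpG, hn⟩
  · obtain ⟨p, hpG, hp⟩ := hGE _ (Or.inr ⟨(y, n), rfl⟩)
    refine (p.s.image Prod.fst).finite_toSet.subset ?_
    rintro x ⟨hxV, q, hqG, hxq⟩
    obtain ⟨r, -, hrp, hrq⟩ := hG p hpG q hqG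
    by_contra hx
    refine (SplitCond.le_def.1 hrp).2.2 (x, n) (hrq.1 hxq) (fun h => hx ?_) (y, n) hp rfl hxV
    exact Finset.mem_coe.2 (Finset.mem_image_of_mem Prod.fst h)

theorem SplitCond.exists_le_le {Z : Type} {V : Z → Set Z} {p q : SplitCond V}
    (hpq : ∀ u ∈ p.s, u ∉ q.s → ∀ v ∈ q.F, u.1 ∉ V v.1)
    (hqp : ∀ u ∈ q.s, u ∉ p.s → ∀ v ∈ p.F, u.1 ∉ V v.1) : ∃ r, r ≤ p ∧ r ≤ q := by
  classical
  refine ⟨⟨p.s ∪ q.s, p.F ∪ q.F⟩,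
    ⟨Finset.subset_union_left, Finset.subset_union_left, fun u hu hup v hv _ => ?_⟩,
    ⟨Finset.subset_union_right, Finset.subset_union_right, fun u hu huq v hv _ => ?_⟩⟩
  · exact hqp u ((Finset.mem_union.1 hu).resolve_left hup) hup v hv
  · exact hpq u ((Finset.mem_union.1 hu).resolve_right huq) huq v hv

/-- If `X` is tight at infinity, then the forcing that splits `X` into sets having finite
intersection with given compact sets is ccc. -/
theorem TightAtInfty.cccOrder_splitCond {X : Type*} [TopologicalSpace X] [T2Space X]
    [WeaklyLocallyCompactSpace X] (hX : TightAtInfty X) (hc : LocallyCountable X)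
    {Z : Type} (g : Z ≃ X) (V : X → Set X) (hV : ∀ x, IsCompact (V x)) :
    CCCOrder (SplitCond fun z : Z => g ⁻¹' V (g z)) := by
  classical
  intro A hA
  by_contra hunc
  obtain ⟨N, hN⟩ : ∃ N, ¬{p ∈ A | p.s.card = N}.Countable := by
    by_contra! h
    refine hunc ((countable_iUnion h).mono fun p hp => ?_)
    exact mem_iUnion.2 ⟨p.s.card, hp, rfl⟩
  obtain ⟨R, B, hBA, hB, hBR, hcount⟩ :=
    exists_finset_root (fun p => p.s) _ hN N fun p hp => hp.2
  have henum : ∀ p ∈ B, ∃ f : Fin (N - R.card) → Z × ℕ, range f = ↑(p.s \ R) := by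
    intro p hp
    have hcard : (p.s \ R).card = N - R.card := by
      rw [Finset.card_sdiff_of_subset (hBR p hp), (hBA hp).2]
    refine ⟨fun j => (Finset.equivFinOfCardEq hcard).symm j, ?_⟩
    exact ((Finset.equivFinOfCardEq hcard).symm.surjective.range_comp Subtype.val).trans
      Subtype.range_coe
  obtain ⟨p₀, hp₀⟩ : B.Nonempty := by
    by_contra h
    exact hB (not_nonempty_iff_eq_empty.1 h ▸ countable_empty)
  have := (henum p₀ hp₀).nonempty
  choose! f hf using henum
  have hmeet : ∀ K : Set X, K.Countable →
      {p ∈ B | ∃ u ∈ p.s, u ∉ R ∧ g u.1 ∈ K}.Countable := by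
    intro K hK
    have hK' : {u : Z × ℕ | g u.1 ∈ K ∧ u ∉ R}.Countable := by
      refine ((hK.preimage g.injective).prod (countable_univ (α := ℕ))).mono ?_
      exact fun u hu => ⟨hu.1, mem_univ _⟩
    refine (hK'.biUnion fun u hu => hcount u hu.2).mono ?_
    rintro p ⟨hp, u, hu, huR, huK⟩
    exact mem_biUnion (show u ∈ {u : Z × ℕ | g u.1 ∈ K ∧ u ∉ R} from ⟨huK, huR⟩) ⟨hp, hu⟩
  have havoid : ∀ K : Set X, K.Countable → ∀ C : Set _, C.Countable →
      ∃ p ∈ B, p ∉ C ∧ ∀ u ∈ p.s, u ∉ R → g u.1 ∉ K := by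
    intro K hK C hC
    by_contra! h
    refine hB (((hmeet K hK).union hC).mono fun p hp => ?_)
    by_cases hpC : p ∈ C
    · exact Or.inr hpC
    · exact Or.inl ⟨hp, h p hp hpC⟩
  obtain ⟨C, hCB, hCc, hC⟩ := hX.exists_countable _ (fun p j => g (f p j).1) B fun K hK => by
    obtain ⟨p, hp, -, hpK⟩ := havoid K (hc.countable_of_isCompact hK) ∅ countable_empty
    refine ⟨p, hp, fun j => ?_⟩
    have hj : f p j ∈ (↑(p.s \ R) : Set (Z × ℕ)) := hf p hp ▸ mem_range_self j
    rw [Finset.mem_coe, Finset.mem_sdiff] at hj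
    exact hpK _ hj.1 hj.2
  have hKc : ∀ p : SplitCond fun z : Z => g ⁻¹' V (g z), IsCompact (⋃ v ∈ p.F, V (g v.1)) :=
    fun p => p.F.isCompact_biUnion fun v _ => hV _
  obtain ⟨p, hpB, hpC, hp⟩ := havoid (⋃ q ∈ C, ⋃ v ∈ q.F, V (g v.1))
    (hCc.biUnion fun q _ => hc.countable_of_isCompact (hKc q)) C hCc
  obtain ⟨q, hqC, hq⟩ := hC _ (hKc p)
  have hqB := hCB hqC
  refine hA p (hBA hpB).1 q (hBA hqB).1 (fun h => hpC (h ▸ hqC)) (SplitCond.exists_le_le ?_ ?_)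
  · intro u hu huq v hv huv
    exact hp u hu (fun hR => huq (hBR q hqB hR)) (mem_biUnion hqC (mem_biUnion hv huv))
  · intro u hu hup v hv huv
    have hur : u ∈ range (f q) := by
      rw [hf q hqB, Finset.mem_coe, Finset.mem_sdiff]
      exact ⟨hu, fun hR => hup (hBR p hpB hR)⟩
    obtain ⟨j, rfl⟩ := hur
    exact hq j (mem_biUnion hv huv)

theorem TightAtInfty.exists_iUnion_closedDiscrete (hMA : MartinsAxiom) {X : Type*}
    [TopologicalSpace X] [T2Space X] [WeaklyLocallyCompactSpace X] (hX : TightAtInfty X)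
    (hc : LocallyCountable X) (hcard : #X < 2 ^ ℵ₀) :
    ∃ D : ℕ → Set X, (∀ n, IsClosed (D n) ∧ DiscreteTopology ↥(D n)) ∧
      ⋃ n, D n = Set.univ := by
  have hlift : #X < lift (2 ^ ℵ₀ : Cardinal.{0}) := by simpa using hcard
  obtain ⟨c, hc', hcX⟩ := lt_lift_iff.1 hlift
  obtain ⟨g⟩ : Nonempty (c.out ≃ X) := by
    rw [← lift_mk_eq', mk_out, hcX, lift_uzero]
  choose V hV hVx using fun x : X => exists_compact_mem_nhds x
  obtain ⟨D, hD, hDV⟩ := hMA.exists_split (by rwa [mk_out]) _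
    (hX.cccOrder_splitCond hc g V hV)
  refine ⟨fun n => g '' D n, fun n => isClosed_and_discreteTopology_iff.2 fun x => ?_, ?_⟩
  · refine ⟨V x, hVx x, ((hDV n (g.symm x)).image g).subset ?_⟩
    rintro _ ⟨hy, z, hz, rfl⟩
    exact ⟨z, ⟨by simpa using hy, hz⟩, rfl⟩
  · rw [← image_iUnion, hD, image_univ, g.range_eq_univ]

/-- Under MA, for a locally countable, locally compact Hausdorff space of
cardinality `< 2^ℵ₀`, being σ-closed-discrete, D, linearly D and `(*)` are all
equivalent. -/
theorem stmt5 (hMA : MartinsAxiom) (X : Type*) [TopologicalSpace X] [T2Space X]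
    (h1 : LocallyCountable X) (h2 : LocallyCompactSpace X)
    (hcard : #X < 2 ^ Cardinal.aleph0) :
    ((∃ D : ℕ → Set X, (∀ n, IsClosed (D n) ∧ DiscreteTopology ↥(D n)) ∧
        ⋃ n, D n = Set.univ) ↔ IsDSpace X) ∧
    (IsDSpace X ↔ IsLinearlyDSpace X) ∧
    (IsLinearlyDSpace X ↔ SatisfiesStar X) := by
  have hsplit : TightAtInfty X → _ := fun h => h.exists_iUnion_closedDiscrete hMA h1 hcard
  have hlin : IsLinearlyDSpace X → _ := fun h => hsplit (h.tightAtInfty h1)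
  refine ⟨⟨fun ⟨D, hD, hcov⟩ => isDSpace_of_iUnion_closedDiscrete hD hcov,
    fun h => hlin h.isLinearlyDSpace⟩, ⟨IsDSpace.isLinearlyDSpace, fun h => ?_⟩,
    ⟨fun h => ?_, fun h => ?_⟩⟩
  · obtain ⟨D, hD, hcov⟩ := hlin h
    exact isDSpace_of_iUnion_closedDiscrete hD hcov
  · obtain ⟨D, hD, hcov⟩ := hlin h
    exact satisfiesStar_of_iUnion_closedDiscrete hD hcov
  · obtain ⟨D, hD, hcov⟩ := hsplit (h.tightAtInfty h1)
    exact (isDSpace_of_iUnion_closedDiscrete hD hcov).isLinearlyDSpace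
end

section
/- There exists (in ZFC) a locally countable, locally compact, 0-dimensional T₂ topological space X of cardinality 2^ℵ⁰ such that X is a D-space but X does not satisfy (*). -/
open Set Cardinal Topology Filter

/-- `X` is *0-dimensional*: it has a base consisting of clopen sets. -/
def ZeroDimensional (X : Type*) [TopologicalSpace X] : Prop :=
  ∀ (x : X) (U : Set X), IsOpen U → x ∈ U → ∃ V : Set X, IsClopen V ∧ x ∈ V ∧ V ⊆ U

section PsiSpace

variable {I : Type}

/-- An *almost disjoint family* of countably infinite sets. -/
def IsAlmostDisjointFamily (M : Set (Set I)) : Prop :=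
  (∀ s ∈ M, s.Countable ∧ s.Infinite) ∧ M.Pairwise fun s t => (s ∩ t).Finite

/-- There is an almost disjoint family some member of which meets any given infinite set in an
infinite set. -/
theorem exists_isAlmostDisjointFamily_forall_infinite (I : Type) :
    ∃ M : Set (Set I), IsAlmostDisjointFamily M ∧
      ∀ B : Set I, B.Infinite → ∃ m ∈ M, (m ∩ B).Infinite := by
  obtain ⟨M, hM⟩ := zorn_subset {M : Set (Set I) | IsAlmostDisjointFamily M} (by
    intro c hc hchain
    refine ⟨⋃₀ c, ⟨?_, ?_⟩, fun s hs => subset_sUnion_of_mem hs⟩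
    · rintro s ⟨N, hN, hs⟩
      exact (hc hN).1 s hs
    · exact (pairwise_sUnion hchain.directedOn).2 fun N hN => (hc hN).2)
  refine ⟨M, hM.prop, fun B hB => ?_⟩
  by_contra! h
  obtain ⟨C, hCB, hC, hCc⟩ : ∃ C ⊆ B, C.Infinite ∧ C.Countable :=
    ⟨range fun n => (hB.natEmbedding B n : I), range_subset_iff.2 fun n => (hB.natEmbedding B n).2,
      infinite_range_of_injective (Subtype.coe_injective.comp (hB.natEmbedding B).injective),
      countable_range _⟩
  have hfin : ∀ m ∈ M, (m ∩ C).Finite := fun m hm =>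
    (h m hm).subset (inter_subset_inter_right m hCB)
  have hins : IsAlmostDisjointFamily (insert C M) := by
    refine ⟨?_, ?_⟩
    · rintro s (rfl | hs)
      · exact ⟨hCc, hC⟩
      · exact hM.prop.1 s hs
    · refine hM.prop.2.insert fun m hm _ => ⟨?_, hfin m hm⟩
      rw [inter_comm]
      exact hfin m hm
  have hmem : C ∈ M := hM.le_of_ge hins (subset_insert C M) (mem_insert C M)
  have := hfin C hmem
  rw [inter_self] at this
  exact hC this

/-- The Mrówka–Isbell space of a family `M` of subsets of `I`: the points of `I` are isolated, and
neighborhoods of `m ∈ M` contain all but finitely many elements of `m`. -/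
def PsiSpace (M : Set (Set I)) : Type := I ⊕ M

namespace PsiSpace

variable {M : Set (Set I)}

/-- The isolated point of `PsiSpace M` given by an element of `I`. -/
def point (a : I) : PsiSpace M := Sum.inl a

/-- The limit point of `PsiSpace M` given by a member of `M`. -/
def limit (m : M) : PsiSpace M := Sum.inr m

theorem point_injective : Function.Injective (point : I → PsiSpace M) := Sum.inl_injective

theorem limit_injective : Function.Injective (limit : M → PsiSpace M) := Sum.inr_injective

@[simp] theorem point_inj {a b : I} : (point a : PsiSpace M) = point b ↔ a = b :=
  point_injective.eq_iff

@[simp] theorem limit_inj {m n : M} : limit m = limit n ↔ m = n := limit_injective.eq_iff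

@[simp] theorem point_ne_limit (a : I) (m : M) : point a ≠ limit m := Sum.inl_ne_inr

@[simp] theorem limit_ne_point (a : I) (m : M) : limit m ≠ point a := Sum.inr_ne_inl

theorem eq_point_or_eq_limit (x : PsiSpace M) : (∃ a, x = point a) ∨ ∃ m, x = limit m := by
  rcases x with a | m
  · exact Or.inl ⟨a, rfl⟩
  · exact Or.inr ⟨m, rfl⟩

instance : TopologicalSpace (PsiSpace M) where
  IsOpen U := ∀ m : M, limit m ∈ U → (m.1 \ point ⁻¹' U).Finite
  isOpen_univ := by simp
  isOpen_inter U V hU hV m hm := by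
    rw [preimage_inter, sdiff_inter]
    exact (hU m hm.1).union (hV m hm.2)
  isOpen_sUnion S hS m := by
    rintro ⟨U, hU, hm⟩
    exact (hS U hU m hm).subset
      (sdiff_subset_sdiff_right (preimage_mono (subset_sUnion_of_mem hU)))

theorem isOpen_iff {U : Set (PsiSpace M)} :
    IsOpen U ↔ ∀ m : M, limit m ∈ U → (m.1 \ point ⁻¹' U).Finite := Iff.rfl

theorem isOpen_of_subset_range_point {U : Set (PsiSpace M)} (hU : U ⊆ range point) :
    IsOpen U := by
  intro m hm
  obtain ⟨a, ha⟩ := hU hm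
  exact absurd ha (point_ne_limit a m)

/-- The limit point `limit m` together with the elements of `m` that lie in `U`. -/
def basicNhd (m : M) (U : Set (PsiSpace M)) : Set (PsiSpace M) :=
  insert (limit m) (point '' m.1 ∩ U)

theorem isOpen_basicNhd {m : M} {U : Set (PsiSpace M)} (hU : IsOpen U) (hm : limit m ∈ U) :
    IsOpen (basicNhd m U) := by
  intro n hn
  have hnm : n = m := by simpa [basicNhd] using hn
  subst hnm
  refine (hU n hm).subset fun a ha => ⟨ha.1, fun haU => ha.2 ?_⟩
  exact Or.inr ⟨mem_image_of_mem _ ha.1, haU⟩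

theorem isClosed_basicNhd (hM : IsAlmostDisjointFamily M) (m : M) (U : Set (PsiSpace M)) :
    IsClosed (basicNhd m U) := by
  rw [← isOpen_compl_iff]
  intro n hn
  have hnm : n ≠ m := fun h => hn (h ▸ mem_insert _ _)
  refine (hM.2 n.2 m.2 (Subtype.coe_injective.ne hnm)).subset fun a ha => ⟨ha.1, ?_⟩
  have : point a ∈ basicNhd m U := by simpa using ha.2
  simpa [basicNhd] using (this.resolve_left (point_ne_limit a m)).1

theorem isCompact_basicNhd (m : M) (U : Set (PsiSpace M)) : IsCompact (basicNhd m U) := by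
  rw [isCompact_iff_ultrafilter_le_nhds']
  intro f hf
  by_cases hle : ↑f ≤ 𝓝 (limit m)
  · exact ⟨limit m, mem_insert _ _, hle⟩
  obtain ⟨V, ⟨hmV, hV⟩, hVf⟩ : ∃ V : Set (PsiSpace M), (limit m ∈ V ∧ IsOpen V) ∧ V ∉ f := by
    by_contra! h
    exact hle ((nhds_basis_opens _).ge_iff.2 h)
  have hfin : (basicNhd m U \ V).Finite := by
    refine ((hV m hmV).image point).subset ?_
    rintro x ⟨rfl | ⟨⟨a, ha, rfl⟩, -⟩, hxV⟩
    · exact absurd hmV hxV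
    · exact ⟨a, ⟨ha, hxV⟩, rfl⟩
  obtain ⟨x, hx, hfx⟩ := isCompact_iff_ultrafilter_le_nhds'.1 hfin.isCompact f
    (inter_mem hf (Ultrafilter.compl_mem_iff_notMem.2 hVf))
  exact ⟨x, hx.1, hfx⟩

theorem countable_basicNhd (hM : IsAlmostDisjointFamily M) (m : M) (U : Set (PsiSpace M)) :
    (basicNhd m U).Countable :=
  ((((hM.1 m m.2).1.image _).mono inter_subset_left).insert _)

instance : T1Space (PsiSpace M) where
  t1 x := by
    rw [← isOpen_compl_iff, isOpen_iff]
    intro m _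
    refine Set.Finite.subset (s := point ⁻¹' {x})
      ((finite_singleton x).preimage point_injective.injOn) fun a ha => ?_
    simpa using ha.2

/-- Every point of `PsiSpace M` has arbitrarily small countable compact clopen neighborhoods. -/
theorem exists_isClopen_isCompact_countable (hM : IsAlmostDisjointFamily M) (x : PsiSpace M)
    (U : Set (PsiSpace M)) (hU : IsOpen U) (hx : x ∈ U) :
    ∃ V, IsClopen V ∧ IsCompact V ∧ V.Countable ∧ x ∈ V ∧ V ⊆ U := by
  obtain ⟨a, rfl⟩ | ⟨m, rfl⟩ := eq_point_or_eq_limit x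
  · exact ⟨{point a}, ⟨isClosed_singleton, isOpen_of_subset_range_point (by simp)⟩,
      isCompact_singleton, countable_singleton _, rfl, singleton_subset_iff.2 hx⟩
  · exact ⟨basicNhd m U, ⟨isClosed_basicNhd hM m U, isOpen_basicNhd hU hx⟩,
      isCompact_basicNhd m U, countable_basicNhd hM m U, mem_insert _ _,
      insert_subset hx inter_subset_right⟩

theorem zeroDimensional (hM : IsAlmostDisjointFamily M) : ZeroDimensional (PsiSpace M) := by
  intro x U hU hx
  obtain ⟨V, hV, -, -, hxV, hVU⟩ := exists_isClopen_isCompact_countable hM x U hU hx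
  exact ⟨V, hV, hxV, hVU⟩

theorem locallyCountable (hM : IsAlmostDisjointFamily M) : LocallyCountable (PsiSpace M) := by
  intro x
  obtain ⟨V, hV, -, hc, hxV, -⟩ :=
    exists_isClopen_isCompact_countable hM x univ isOpen_univ (mem_univ x)
  exact ⟨V, hV.isOpen.mem_nhds hxV, hc⟩

theorem locallyCompactSpace (hM : IsAlmostDisjointFamily M) :
    LocallyCompactSpace (PsiSpace M) where
  local_compact_nhds x n hn := by
    obtain ⟨U, hUn, hU, hx⟩ := mem_nhds_iff.1 hn
    obtain ⟨V, hV, hc, -, hxV, hVU⟩ := exists_isClopen_isCompact_countable hM x U hU hx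
    exact ⟨V, hV.isOpen.mem_nhds hxV, hVU.trans hUn, hc⟩

theorem t2Space (hM : IsAlmostDisjointFamily M) : T2Space (PsiSpace M) where
  t2 x y hxy := by
    obtain ⟨V, hV, hxV, hVy⟩ := zeroDimensional hM x {y}ᶜ isOpen_compl_singleton hxy
    exact ⟨V, Vᶜ, hV.isOpen, hV.compl.isOpen, hxV, fun h => hVy h rfl, disjoint_compl_right⟩

/-- Given an open neighborhood assignment, the limit points together with the isolated points not
covered by the neighborhoods of the limit points form a closed discrete set. -/
theorem isDSpace : IsDSpace (PsiSpace M) := by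
  intro U hU hxU
  have hdisj : ∀ (m : M) (a : I), point a ∈ U (limit m) →
      point a ∉ range limit ∪ {x | ∀ n : M, x ∉ U (limit n)} := by
    rintro m a ha (⟨n, hn⟩ | hn)
    · exact point_ne_limit a n hn.symm
    · exact hn m ha
  refine ⟨range limit ∪ {x | ∀ n : M, x ∉ U (limit n)}, ?_, ?_, ?_⟩
  · rw [← isOpen_compl_iff]
    refine isOpen_of_subset_range_point fun x hx => ?_
    obtain ⟨a, rfl⟩ | ⟨m, rfl⟩ := eq_point_or_eq_limit x
    · exact mem_range_self a
    · exact absurd (Or.inl (mem_range_self m)) hx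
  · rw [discreteTopology_subtype_iff']
    intro x hx
    obtain ⟨a, rfl⟩ | ⟨m, rfl⟩ := eq_point_or_eq_limit x
    · exact ⟨{point a}, isOpen_of_subset_range_point (by simp),
        inter_eq_left.2 (singleton_subset_iff.2 hx)⟩
    · refine ⟨basicNhd m (U (limit m)), isOpen_basicNhd (hU _) (hxU _), ?_⟩
      refine Subset.antisymm ?_ (singleton_subset_iff.2 ⟨mem_insert _ _, hx⟩)
      rintro y ⟨rfl | ⟨⟨a, -, rfl⟩, haU⟩, hy⟩
      · rfl
      · exact absurd hy (hdisj m a haU)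
  · refine eq_univ_of_forall fun x => ?_
    by_cases hx : ∀ n : M, x ∉ U (limit n)
    · exact mem_biUnion (Or.inr hx) (hxU x)
    · push Not at hx
      obtain ⟨n, hn⟩ := hx
      exact mem_biUnion (Or.inl (mem_range_self n)) hn

theorem not_isClosed_image_point (hmax : ∀ B : Set I, B.Infinite → ∃ m ∈ M, (m ∩ B).Infinite)
    {B : Set I} (hB : B.Infinite) : ¬IsClosed (point '' B : Set (PsiSpace M)) := by
  intro hcl
  obtain ⟨m, hm, hmB⟩ := hmax B hB
  refine hmB ((isOpen_iff.1 hcl.isOpen_compl ⟨m, hm⟩ (by simp)).subset fun a ha => ?_)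
  exact ⟨ha.1, by simpa using ha.2⟩

theorem not_satisfiesStar [Uncountable I] (hM : IsAlmostDisjointFamily M)
    (hmax : ∀ B : Set I, B.Infinite → ∃ m ∈ M, (m ∩ B).Infinite) :
    ¬SatisfiesStar (PsiSpace M) := by
  intro h
  obtain ⟨A, hA⟩ : ∃ A : Set I, #A = ℵ₁ :=
    le_mk_iff_exists_set.1 (by rw [← succ_aleph0, Order.succ_le_iff]; exact aleph0_lt_mk_iff.2 ‹_›)
  have hA' : #(point '' A : Set (PsiSpace M)) = ℵ₁ := by
    rw [mk_image_eq point_injective, hA]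
  obtain ⟨x, hx⟩ | ⟨B, hBA, hB, hcl, -⟩ := h ℵ₁ isRegular_aleph_one aleph0_lt_aleph_one _ hA'
  · obtain ⟨V, hV, -, hc, hxV, -⟩ :=
      exists_isClopen_isCompact_countable hM x univ isOpen_univ (mem_univ x)
    have hle := (hc.mono (inter_subset_left (t := point '' A))).le_aleph0
    rw [hx V hV.isOpen hxV, hA'] at hle
    exact aleph0_lt_aleph_one.not_ge hle
  · obtain ⟨C, -, rfl⟩ := subset_image_iff.1 hBA
    refine not_isClosed_image_point hmax (fun hC => ?_) hcl
    have := (hC.image (point : I → PsiSpace M)).lt_aleph0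
    rw [hB] at this
    exact aleph0_lt_aleph_one.not_gt this

theorem mk_eq_continuum (hI : #I = 𝔠) (hM : IsAlmostDisjointFamily M) :
    #(PsiSpace M) = 𝔠 := by
  have hex : ∀ m : M, ∃ f : ℕ → I, m.1 = range f := fun m =>
    (hM.1 m m.2).1.exists_eq_range (hM.1 m m.2).2.nonempty
  choose f hf using hex
  have hinj : Function.Injective f := fun m n h => Subtype.ext (by rw [hf, hf, h])
  have hle : #M ≤ 𝔠 := by
    have := mk_le_of_injective hinj
    simpa [hI] using this
  calc #(PsiSpace M) = #I + #M := by simp [PsiSpace]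
    _ = 𝔠 := by rw [hI, add_eq_left aleph0_le_continuum hle]

end PsiSpace

end PsiSpace

/-- In ZFC there is a locally countable, locally compact, 0-dimensional `T₂`
D-space of cardinality `2^ℵ₀` not satisfying `(*)`. -/
theorem stmt6 :
    ∃ (X : Type) (t : TopologicalSpace X),
      @LocallyCountable X t ∧ @LocallyCompactSpace X t ∧ @ZeroDimensional X t ∧
      @T2Space X t ∧ #X = 2 ^ Cardinal.aleph0 ∧ @IsDSpace X t ∧ ¬@SatisfiesStar X t := by
  obtain ⟨M, hM, hmax⟩ := exists_isAlmostDisjointFamily_forall_infinite ℝ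
  exact ⟨PsiSpace M, inferInstance, PsiSpace.locallyCountable hM, PsiSpace.locallyCompactSpace hM,
    PsiSpace.zeroDimensional hM, PsiSpace.t2Space hM, PsiSpace.mk_eq_continuum mk_real hM,
    PsiSpace.isDSpace, PsiSpace.not_satisfiesStar hM hmax⟩
end

section
/- There exists (in ZFC) a locally countable, locally compact, 0-dimensional T₂ topological space X of cardinality 2^ℵ⁰ such that X is not linearly D but X satisfies (**). -/
open Set Cardinal Topology Filter

/-- `X` satisfies `(**)`: for every regular uncountable `κ` and every `A ⊆ X` of
cardinality `κ`, either `A` has a complete accumulation point or the closure of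
`A` has a subset of cardinality `κ` which is closed and discrete in `X`. -/
def SatisfiesStarStar (X : Type*) [TopologicalSpace X] : Prop :=
  ∀ κ : Cardinal, κ.IsRegular → Cardinal.aleph0 < κ → ∀ A : Set X, #↥A = κ →
    (∃ x : X, IsCompleteAccPt x A) ∨
      ∃ D : Set X, D ⊆ closure A ∧ #↥D = κ ∧ IsClosed D ∧ DiscreteTopology ↥D

/-- Data for refining a subspace of the Cantor space: every point has a rank in `W`, and some points
come with a sequence of points of smaller rank converging to them in the Cantor space, whose ranks
are cofinal below the rank of the limit. -/
structure LadderSystem (X W : Type*) [LinearOrder W] where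
  code : X → ℕ → Bool
  code_injective : Function.Injective code
  rank : X → W
  limits : Set X
  ladder : X → ℕ → X
  bound : X → ℕ → W
  code_ladder : ∀ p ∈ limits, ∀ n, ∀ i < n, code (ladder p n) i = code p i
  bound_lt : ∀ p ∈ limits, ∀ n, bound p n < rank (ladder p n)
  rank_ladder_lt : ∀ p ∈ limits, ∀ n, rank (ladder p n) < rank p
  bound_cofinal : ∀ p ∈ limits, ∀ b < rank p, ∃ k, ∀ n ≥ k, b ≤ bound p n

namespace LadderSystem

variable {X W : Type*} [LinearOrder W] (S : LadderSystem X W)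

/-- The relation of `q` lying in the `k`-th basic neighborhood of `p`. -/
inductive Near : X → ℕ → X → Prop
  | refl (p : X) (k : ℕ) : Near p k p
  | step {p : X} {k n : ℕ} {q : X} (hp : p ∈ S.limits) (hkn : k ≤ n)
      (hq : Near (S.ladder p n) n q) (hb : S.bound p n < S.rank q) : Near p k q

/-- The underlying set of a ladder system, to be topologized by the basic neighborhoods. -/
def Space (_ : LadderSystem X W) : Type _ := X

/-- The `k`-th basic neighborhood of `p`. -/
def basic (p : S.Space) (k : ℕ) : Set S.Space := {q | S.Near p k q}

variable {S}

theorem mem_basic_self (p : S.Space) (k : ℕ) : p ∈ S.basic p k := Near.refl p k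

theorem basic_anti (p : S.Space) {j k : ℕ} (h : j ≤ k) : S.basic p k ⊆ S.basic p j := by
  intro q hq
  cases hq with
  | refl => exact Near.refl _ _
  | step hp hkn hq hb => exact Near.step hp (h.trans hkn) hq hb

instance : TopologicalSpace S.Space where
  IsOpen U := ∀ p ∈ U, ∃ k, S.basic p k ⊆ U
  isOpen_univ _ _ := ⟨0, subset_univ _⟩
  isOpen_inter U V hU hV p hp := by
    obtain ⟨j, hj⟩ := hU p hp.1
    obtain ⟨k, hk⟩ := hV p hp.2
    exact ⟨max j k, subset_inter ((basic_anti p (le_max_left _ _)).trans hj)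
      ((basic_anti p (le_max_right _ _)).trans hk)⟩
  isOpen_sUnion 𝒰 h𝒰 p hp := by
    obtain ⟨U, hU, hpU⟩ := hp
    obtain ⟨k, hk⟩ := h𝒰 U hU p hpU
    exact ⟨k, hk.trans (subset_sUnion_of_mem hU)⟩

theorem rank_le_of_mem_basic {p q : S.Space} {k : ℕ} (h : q ∈ S.basic p k) :
    S.rank q ≤ S.rank p := by
  induction h with
  | refl => exact le_rfl
  | step hp _ _ _ ih => exact ih.trans (S.rank_ladder_lt _ hp _).le

theorem eq_of_mem_basic_of_rank_le {p q : S.Space} {k : ℕ} (h : q ∈ S.basic p k)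
    (hr : S.rank p ≤ S.rank q) : q = p := by
  cases h with
  | refl => rfl
  | @step _ _ n _ hp _ hq _ =>
    have : S.rank q ≤ S.rank (S.ladder p n) := rank_le_of_mem_basic hq
    exact absurd (hr.trans this) (S.rank_ladder_lt _ hp _).not_ge

theorem code_eq_of_mem_basic {p q : S.Space} {k : ℕ} (h : q ∈ S.basic p k) :
    ∀ i < k, S.code q i = S.code p i := by
  induction h with
  | refl => exact fun _ _ => rfl
  | step hp hkn _ _ ih =>
    intro i hi
    rw [ih i (hi.trans_le hkn), S.code_ladder _ hp _ i (hi.trans_le hkn)]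

theorem isOpen_rank_le (b : W) : IsOpen {p : S.Space | S.rank p ≤ b} :=
  fun _ hp => ⟨0, fun _ hq => (rank_le_of_mem_basic hq).trans hp⟩

theorem isOpen_rank_lt (b : W) : IsOpen {p : S.Space | S.rank p < b} :=
  fun _ hp => ⟨0, fun _ hq => (rank_le_of_mem_basic hq).trans_lt hp⟩

theorem isOpen_lt_rank (b : W) : IsOpen {p : S.Space | b < S.rank p} := by
  intro p hp
  by_cases hl : p ∈ S.limits
  · obtain ⟨k, hk⟩ := S.bound_cofinal p hl b hp
    refine ⟨k, fun q hq => ?_⟩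
    cases hq with
    | refl => exact hp
    | step _ hkn _ hb => exact (hk _ hkn).trans_lt hb
  · refine ⟨0, fun q hq => ?_⟩
    cases hq with
    | refl => exact hp
    | step hl' => exact absurd hl' hl

theorem isOpen_basic (p : S.Space) (k : ℕ) : IsOpen (S.basic p k) := by
  intro q hq
  induction hq with
  | refl p k => exact ⟨k, Subset.rfl⟩
  | @step p k n q hp hkn hq hb ih =>
    obtain ⟨i, hi⟩ := ih
    obtain ⟨j, hj⟩ := isOpen_lt_rank (S := S) (S.bound p n) q hb
    exact ⟨max i j, fun r hr => Near.step hp hkn (hi (basic_anti q (le_max_left _ _) hr))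
      (hj (basic_anti q (le_max_right _ _) hr))⟩

theorem basic_mem_nhds (p : S.Space) (k : ℕ) : S.basic p k ∈ 𝓝 p :=
  (isOpen_basic p k).mem_nhds (mem_basic_self p k)

instance : T2Space S.Space where
  t2 p q hpq := by
    obtain ⟨i, hi⟩ := Function.ne_iff.1 (S.code_injective.ne hpq)
    have hopen (c : Bool) : IsOpen {r : S.Space | S.code r i = c} := fun r hr =>
      ⟨i + 1, fun s hs => (code_eq_of_mem_basic hs i i.lt_succ_self).trans hr⟩
    exact ⟨_, _, hopen _, hopen _, rfl, rfl,
      Set.disjoint_left.2 fun r hp hq => hi (hp.symm.trans hq)⟩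

theorem basic_eq_of_mem_limits {p : S.Space} (hp : p ∈ S.limits) {k j : ℕ} (hkj : k ≤ j) :
    S.basic p k = S.basic p j ∪
      ⋃ n ∈ Ico k j, S.basic (S.ladder p n) n ∩ {q | S.bound p n < S.rank q} := by
  ext q
  simp only [mem_union, mem_iUnion, mem_inter_iff, exists_prop]
  constructor
  · intro h
    cases h with
    | refl => exact Or.inl (mem_basic_self p j)
    | @step _ _ n _ _ hkn hq hb =>
      by_cases hn : n < j
      · exact Or.inr ⟨n, ⟨hkn, hn⟩, hq, hb⟩
      · exact Or.inl (Near.step hp (not_lt.1 hn) hq hb)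
  · rintro (h | ⟨n, hn, hq, hb⟩)
    · exact basic_anti p hkj h
    · exact Near.step hp hn.1 hq hb

theorem basic_eq_singleton {p : S.Space} (hp : p ∉ S.limits) (k : ℕ) : S.basic p k = {p} := by
  ext q
  refine ⟨fun h => ?_, fun h => h ▸ mem_basic_self p k⟩
  cases h with
  | refl => rfl
  | step hp' => exact absurd hp' hp

theorem isClosed_lt_rank (b : W) : IsClosed {p : S.Space | b < S.rank p} := by
  simpa [compl_def] using (isOpen_rank_le (S := S) b).isClosed_compl

theorem isCompact_basic [WellFoundedLT W] (p : S.Space) (k : ℕ) : IsCompact (S.basic p k) := by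
  induction hr : S.rank p using WellFoundedLT.induction generalizing p k with
  | _ r ih =>
    subst hr
    by_cases hp : p ∈ S.limits
    · refine isCompact_of_finite_subcover fun {ι} U hU hcov => ?_
      obtain ⟨i, hi⟩ := mem_iUnion.1 (hcov (mem_basic_self p k))
      obtain ⟨j, hj⟩ := hU i p hi
      have hsplit := basic_eq_of_mem_limits hp (le_max_left k j)
      have hK : IsCompact (⋃ n ∈ Ico k (max k j),
          S.basic (S.ladder p n) n ∩ {q | S.bound p n < S.rank q}) :=
        (finite_Ico _ _).isCompact_biUnion fun n _ =>
          (ih _ (S.rank_ladder_lt p hp n) (S.ladder p n) n rfl).inter_right (isClosed_lt_rank _)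
      obtain ⟨t, ht⟩ := hK.elim_finite_subcover U hU
        ((subset_union_right.trans hsplit.ge).trans hcov)
      classical
      refine ⟨insert i t, hsplit.le.trans (union_subset ?_ (ht.trans ?_))⟩
      · exact ((basic_anti p (le_max_right k j)).trans hj).trans
          (subset_biUnion_of_mem (u := U) (Finset.mem_insert_self i t))
      · exact biUnion_subset_biUnion_left fun n hn => Finset.mem_insert_of_mem hn
    · rw [basic_eq_singleton hp]
      exact isCompact_singleton

theorem countable_basic [WellFoundedLT W] (p : S.Space) (k : ℕ) : (S.basic p k).Countable := by
  induction hr : S.rank p using WellFoundedLT.induction generalizing p k with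
  | _ r ih =>
    subst hr
    by_cases hp : p ∈ S.limits
    · refine ((countable_singleton p).union (countable_iUnion fun n =>
        ih _ (S.rank_ladder_lt p hp n) (S.ladder p n) n rfl)).mono fun q hq => ?_
      cases hq with
      | refl => exact Or.inl rfl
      | @step _ _ n _ _ _ hq _ => exact Or.inr (mem_iUnion.2 ⟨n, hq⟩)
    · rw [basic_eq_singleton hp]
      exact countable_singleton p

theorem isClopen_basic [WellFoundedLT W] (p : S.Space) (k : ℕ) : IsClopen (S.basic p k) :=
  ⟨(isCompact_basic p k).isClosed, isOpen_basic p k⟩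

theorem locallyCountable [WellFoundedLT W] : LocallyCountable S.Space :=
  fun p => ⟨_, basic_mem_nhds p 0, countable_basic p 0⟩

theorem zeroDimensional [WellFoundedLT W] : ZeroDimensional S.Space := by
  intro p U hU hp
  obtain ⟨k, hk⟩ := hU p hp
  exact ⟨_, isClopen_basic p k, mem_basic_self p k, hk⟩

instance [WellFoundedLT W] : LocallyCompactSpace S.Space where
  local_compact_nhds p U hU := by
    obtain ⟨V, hVU, hV, hpV⟩ := mem_nhds_iff.1 hU
    obtain ⟨k, hk⟩ := hV p hpV
    exact ⟨_, basic_mem_nhds p k, hk.trans hVU, isCompact_basic p k⟩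

theorem isClosed_of_rank_eq {D : Set S.Space} {b : W} (hD : ∀ p ∈ D, S.rank p = b) :
    IsClosed D := by
  refine ⟨fun p hp => ?_⟩
  rcases lt_trichotomy (S.rank p) b with h | h | h
  · obtain ⟨k, hk⟩ := isOpen_rank_lt (S := S) b p h
    exact ⟨k, fun q hq hqD => (hk hq).ne (hD q hqD)⟩
  · refine ⟨0, fun q hq hqD => hp ?_⟩
    rwa [← eq_of_mem_basic_of_rank_le hq (h.trans (hD q hqD).symm).le]
  · obtain ⟨k, hk⟩ := isOpen_lt_rank (S := S) b p h
    exact ⟨k, fun q hq hqD => (hk hq).ne' (hD q hqD)⟩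

theorem discreteTopology_of_rank_eq {D : Set S.Space} {b : W} (hD : ∀ p ∈ D, S.rank p = b) :
    DiscreteTopology D := by
  refine discreteTopology_subtype_iff'.2 fun p hp => ⟨S.basic p 0, isOpen_basic p 0, ?_⟩
  refine Subset.antisymm (fun q hq => ?_) (by simpa using ⟨mem_basic_self p 0, hp⟩)
  exact eq_of_mem_basic_of_rank_le hq.1 ((hD p hp).trans (hD q hq.2).symm).le

theorem ladder_mem_basic {p : S.Space} (hp : p ∈ S.limits) {k n : ℕ} (h : k ≤ n) :
    S.ladder p n ∈ S.basic p k :=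
  Near.step hp h (Near.refl _ _) (S.bound_lt p hp n)

theorem accPt_of_ladder_mem {p : S.Space} (hp : p ∈ S.limits) {A : Set S.Space}
    (hA : ∀ n, S.ladder p n ∈ A) : AccPt p (𝓟 A) := by
  refine accPt_iff_nhds.2 fun U hU => ?_
  obtain ⟨V, hVU, hV, hpV⟩ := mem_nhds_iff.1 hU
  obtain ⟨k, hk⟩ := hV p hpV
  refine ⟨S.ladder p k, ⟨hVU (hk (ladder_mem_basic hp le_rfl)), hA k⟩, fun h => ?_⟩
  exact (S.rank_ladder_lt p hp k).ne (congrArg S.rank h)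

end LadderSystem

/-- Sets of cardinality `κ`, at most `κ` many of them, have distinct representatives. -/
theorem exists_injective_mem_of_mk_eq {ι X : Type} {κ : Cardinal} (hι : #ι ≤ κ)
    (F : ι → Set X) (hF : ∀ i, #(F i) = κ) : ∃ f : ι → X, Function.Injective f ∧ ∀ i, f i ∈ F i := by
  obtain ⟨_, _, hord⟩ := Cardinal.exists_ord_eq_type_lt ι
  have hstep (i : ι) (g : ∀ j, j < i → X) : ∃ x ∈ F i, ∀ j (hj : j < i), g j hj ≠ x := by
    by_contra! h
    have hsub : F i ⊆ range fun j : Iio i => g j.1 j.2 := fun x hx =>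
      let ⟨j, hj, e⟩ := h x hx
      ⟨⟨j, hj⟩, e⟩
    exact (((mk_le_mk_of_subset hsub).trans mk_range_le).trans_lt
      ((mk_Iio_lt i hord).trans_le hι)).ne (hF i)
  choose g hgF hg using hstep
  let f : ι → X := wellFounded_lt.fix g
  have hf (i : ι) : f i = g i fun j _ => f j := wellFounded_lt.fix_eq g i
  have hne {i j : ι} (h : j < i) : f j ≠ f i := fun e =>
    hg i (fun j _ => f j) j h (e.trans (hf i))
  refine ⟨f, fun i j hij => ?_, fun i => hf i ▸ hgF i _⟩
  rcases lt_trichotomy i j with h | h | h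
  · exact absurd hij (hne h)
  · exact h
  · exact absurd hij.symm (hne h)

theorem exists_linearOrder_omega_one :
    ∃ (W : Type) (_ : LinearOrder W), WellFoundedLT W ∧ #W ≤ 𝔠 ∧
      (∀ a : W, (Iic a).Countable) ∧ ∀ s : Set W, s.Countable → ∃ b, ∀ a ∈ s, a < b := by
  have hIic (a : (ℵ₁ : Cardinal.{0}).ord.ToType) : (Iic a).Countable := by
    rw [← Iio_insert]
    refine Countable.insert a ?_
    have := (mk_Iio_lt a (by simp)).trans_eq (mk_ord_toType ℵ₁)
    exact le_aleph0_iff_set_countable.1 (Order.lt_succ_iff.1 (this.trans_eq succ_aleph0.symm))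
  refine ⟨(ℵ₁ : Cardinal.{0}).ord.ToType, inferInstance, inferInstance, ?_, hIic, ?_⟩
  · rw [mk_ord_toType]
    exact aleph_one_le_continuum
  · intro s hs
    by_contra! h
    have huniv : (univ : Set (ℵ₁ : Cardinal.{0}).ord.ToType) ⊆ ⋃ a ∈ s, Iic a := fun b _ =>
      let ⟨a, ha, hba⟩ := h b
      mem_biUnion ha hba
    have hc := (hs.biUnion fun a _ => hIic a).mono huniv
    rw [← le_aleph0_iff_set_countable, mk_univ, mk_ord_toType] at hc
    exact hc.not_gt aleph0_lt_aleph_one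

theorem mk_closed_eq_continuum {C : Set (ℕ → Bool)} (hC : IsClosed C) (hu : ¬ C.Countable) :
    #C = 𝔠 := by
  refine le_antisymm ((mk_set_le C).trans (by simp)) ?_
  have : PolishSpace (ℕ → Bool) :=
    have : TopologicalSpace.IsCompletelyMetrizableSpace (ℕ → Bool) := inferInstance
    inferInstance
  obtain ⟨f, hf, -, hinj⟩ := hC.exists_nat_bool_injection_of_not_countable hu
  calc 𝔠 = #(ℕ → Bool) := by simp
    _ = #(range f) := (mk_range_eq f hinj).symm
    _ ≤ #C := mk_le_mk_of_subset hf

theorem mem_closure_iff_forall_exists_agree {s : Set (ℕ → Bool)} {p : ℕ → Bool} :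
    p ∈ closure s ↔ ∀ n, ∃ x ∈ s, ∀ i < n, x i = p i := by
  constructor
  · intro h n
    obtain ⟨x, hx, hxs⟩ := mem_closure_iff.1 h _
      (PiNat.isOpen_cylinder (fun _ => Bool) p n) (PiNat.self_mem_cylinder p n)
    exact ⟨x, hxs, fun i hi => hx i hi⟩
  · intro h
    refine mem_closure_iff.2 fun U hU hp => ?_
    obtain ⟨I, u, hu, hIU⟩ := isOpen_pi_iff.1 hU p hp
    obtain ⟨x, hxs, hx⟩ := h (I.sup id + 1)
    refine ⟨x, hIU fun i hi => ?_, hxs⟩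
    rw [hx i (Nat.lt_succ_of_le (Finset.le_sup (f := id) hi))]
    exact (hu i hi).2

theorem exists_seq_uncountable_closure {W : Type} [LinearOrder W] [WellFoundedLT W]
    (hW : ∀ s : Set W, s.Countable → ∃ b, ∀ a ∈ s, a < b) (rank : (ℕ → Bool) → W)
    {A : Set (ℕ → Bool)} (hA : ∀ b, ∃ a ∈ A, b < rank a) :
    ∃ (l : W) (s : ℕ → ℕ → Bool) (β : ℕ → W), ¬ (closure (range s)).Countable ∧ range s ⊆ A ∧
      (∀ b < l, ∃ k, ∀ n ≥ k, b ≤ β n) ∧ ∀ p ∈ closure (range s), ∀ n, ∃ y ∈ range s,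
        (∀ i < n, y i = p i) ∧ β n < rank y ∧ rank y < l := by
  let Q := Σ n : ℕ, (Fin n → Bool)
  let cyl (q : Q) : Set (ℕ → Bool) := {x | ∀ i : Fin q.1, x i = q.2 i}
  let code (p : ℕ → Bool) (n : ℕ) : Q := ⟨n, fun i => p i⟩
  let Unbdd (B : Set (ℕ → Bool)) : Prop := ∀ b, ∃ a ∈ B, b < rank a
  let P : Set (ℕ → Bool) := {p | ∀ n, Unbdd (A ∩ cyl (code p n))}
  obtain ⟨b₀, hb₀⟩ : ∃ b₀, ∀ a ∈ A, b₀ < rank a → a ∈ P := by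
    have (q : Q) : ∃ b, ¬ Unbdd (A ∩ cyl q) → ∀ a ∈ A ∩ cyl q, rank a ≤ b := by
      by_cases h : Unbdd (A ∩ cyl q)
      · exact ⟨rank fun _ => true, fun h' => absurd h h'⟩
      · simp only [Unbdd, not_forall, not_exists, not_and, not_lt] at h
        obtain ⟨b, hb⟩ := h
        exact ⟨b, fun _ => hb⟩
    choose b hb using this
    obtain ⟨b₀, hb₀⟩ := hW (range b) (countable_range b)
    refine ⟨b₀, fun a ha hlt n => ?_⟩
    by_contra h
    exact (hlt.trans_le (hb _ h a ⟨ha, fun _ => rfl⟩)).not_gt (hb₀ _ (mem_range_self _))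
  have hpick (b : W) (q : Q) :
      ∃ a ∈ A ∩ P, b < rank a ∧ (Unbdd (A ∩ cyl q) → a ∈ cyl q) := by
    by_cases h : Unbdd (A ∩ cyl q)
    · obtain ⟨a, ha, hlt⟩ := h (max b b₀)
      exact ⟨a, ⟨ha.1, hb₀ a ha.1 ((le_max_right _ _).trans_lt hlt)⟩,
        (le_max_left _ _).trans_lt hlt, fun _ => ha.2⟩
    · obtain ⟨a, ha, hlt⟩ := hA (max b b₀)
      exact ⟨a, ⟨ha, hb₀ a ha ((le_max_right _ _).trans_lt hlt)⟩,
        (le_max_left _ _).trans_lt hlt, fun h' => absurd h' h⟩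
  choose x hxAP hxlt hxcyl using hpick
  have hnext (b : W) : ∃ b', b < b' ∧ ∀ q, rank (x b q) < b' := by
    obtain ⟨b', hb'⟩ := hW (insert b (range fun q => rank (x b q)))
      ((countable_range _).insert b)
    exact ⟨b', hb' _ (mem_insert _ _), fun q => hb' _ (mem_insert_of_mem _ (mem_range_self q))⟩
  choose next hnext hxnext using hnext
  let β : ℕ → W := fun n => next^[n] b₀
  have hβ (n : ℕ) : β (n + 1) = next (β n) := Function.iterate_succ_apply' next n b₀
  have hmono : StrictMono β := strictMono_nat_of_lt_succ fun n => by
    rw [hβ]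
    exact hnext _
  obtain ⟨l, hl, hlmin⟩ := wellFounded_lt.has_min {c | ∀ n, β n < c} <| by
    obtain ⟨c, hc⟩ := hW (range β) (countable_range β)
    exact ⟨c, fun n => hc _ (mem_range_self n)⟩
  obtain ⟨e, he⟩ := exists_surjective_nat (ℕ × Q)
  let s : ℕ → ℕ → Bool := fun m => x (β (e m).1) (e m).2
  have hmem (n : ℕ) (q : Q) : x (β n) q ∈ range s := by
    obtain ⟨m, hm⟩ := he (n, q)
    exact ⟨m, by simp [s, hm]⟩
  have hsAP : range s ⊆ A ∩ P := by
    rintro _ ⟨m, rfl⟩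
    exact hxAP _ _
  have hxP {p : ℕ → Bool} (hp : p ∈ P) (n : ℕ) : ∀ i < n, x (β n) (code p n) i = p i :=
    fun i hi => hxcyl (β n) (code p n) (hp n) ⟨i, hi⟩
  have hcl : closure (range s) = P := by
    ext p
    rw [mem_closure_iff_forall_exists_agree]
    refine ⟨fun h n => ?_, fun hp n => ⟨_, hmem n (code p n), hxP hp n⟩⟩
    obtain ⟨y, hy, hyp⟩ := h n
    have : code y n = code p n := by
      simp only [code]
      congr 1
      funext i
      exact hyp i i.2
    exact this ▸ (hsAP hy).2 n
  refine ⟨l, s, β, fun hc => ?_, fun y hy => (hsAP hy).1, fun b hb => ?_, fun p hp n => ?_⟩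
  · rw [hcl] at hc
    obtain ⟨b, hb⟩ := hW (rank '' P) (hc.image _)
    obtain ⟨a, ha, hlt⟩ := hA (max b b₀)
    have haP := hb₀ a ha ((le_max_right _ _).trans_lt hlt)
    exact (hb _ (mem_image_of_mem _ haP)).not_gt ((le_max_left _ _).trans_lt hlt)
  · by_contra! h
    refine hlmin b (fun n => ?_) hb
    obtain ⟨m, hm, hlt⟩ := h n
    exact (hmono.monotone hm).trans_lt hlt
  · rw [hcl] at hp
    exact ⟨_, hmem n (code p n), hxP hp n, hxlt _ _, (hxnext _ _).trans (hβ n ▸ hl (n + 1))⟩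

theorem exists_ladderSystem {W : Type} [LinearOrder W] [WellFoundedLT W] (hWc : #W ≤ 𝔠)
    (hW : ∀ s : Set W, s.Countable → ∃ b, ∀ a ∈ s, a < b) :
    ∃ S : LadderSystem (ℕ → Bool) W, Function.Surjective S.rank ∧
      ∀ A : Set (ℕ → Bool), (∀ b, ∃ a ∈ A, b < S.rank a) →
      ∃ (l : W) (D : Set (ℕ → Bool)), #D = 𝔠 ∧
        ∀ p ∈ D, p ∈ S.limits ∧ S.rank p = l ∧ ∀ n, S.ladder p n ∈ A := by
  classical
  let ι := W × (ℕ → ℕ → Bool) × (ℕ → Bool)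
  have hι : #ι ≤ 𝔠 := by
    simp only [ι, mk_prod, lift_id]
    refine (mul_le_mul' hWc (le_of_eq ?_)).trans (continuum_mul_self).le
    simp
  let F (i : ι) : Set (ℕ → Bool) :=
    if (closure (range i.2.1)).Countable then univ else closure (range i.2.1)
  have hF (i : ι) : #(F i) = 𝔠 := by
    simp only [F]
    split_ifs with h
    · simp
    · exact mk_closed_eq_continuum isClosed_closure h
  obtain ⟨pick, hpick, hpickF⟩ := exists_injective_mem_of_mk_eq hι F hF
  obtain ⟨b₀, -⟩ := hW ∅ countable_empty
  have : Nonempty ι := ⟨b₀, fun _ _ => true, fun _ => true⟩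
  let σ : (ℕ → Bool) → ι := Function.invFun pick
  have hσ (i : ι) : σ (pick i) = i := Function.leftInverse_invFun hpick i
  let rank (p : ℕ → Bool) : W := (σ p).1
  let Good (p : ℕ → Bool) (y : ℕ → ℕ → Bool) (β : ℕ → W) : Prop :=
    (∀ n, y n ∈ range (σ p).2.1) ∧ (∀ n, ∀ i < n, y n i = p i) ∧ (∀ n, β n < rank (y n)) ∧
      (∀ n, rank (y n) < rank p) ∧ ∀ b < rank p, ∃ k, ∀ n ≥ k, b ≤ β n
  have hchoice (p : ℕ → Bool) : ∃ y β, (∃ y β, Good p y β) → Good p y β := by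
    by_cases h : ∃ y β, Good p y β
    · obtain ⟨y, β, h⟩ := h
      exact ⟨y, β, fun _ => h⟩
    · exact ⟨fun _ => p, fun _ => b₀, fun h' => absurd h' h⟩
  choose y β hyβ using hchoice
  refine ⟨{ code := id
            code_injective := Function.injective_id
            rank := rank
            limits := {p | ∃ y β, Good p y β}
            ladder := y
            bound := β
            code_ladder := fun p hp => (hyβ p hp).2.1
            bound_lt := fun p hp => (hyβ p hp).2.2.1
            rank_ladder_lt := fun p hp => (hyβ p hp).2.2.2.1
            bound_cofinal := fun p hp => (hyβ p hp).2.2.2.2 },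
    fun b => ⟨pick (b, fun _ _ => true, fun _ => true), by simp [rank, hσ]⟩, fun A hA => ?_⟩
  obtain ⟨l, s, γ, hunc, hsA, hcof, hlad⟩ := exists_seq_uncountable_closure hW rank hA
  refine ⟨l, range fun η => pick (l, s, η), ?_, ?_⟩
  · rw [mk_range_eq _ fun η η' h => congrArg (fun i : ι => i.2.2) (hpick h)]
    simp
  · rintro _ ⟨η, rfl⟩
    have hcl : pick (l, s, η) ∈ closure (range s) := by
      simpa [F, hunc] using hpickF (l, s, η)
    choose z hzs hz hγz hzl using hlad _ hcl
    have hgood : ∃ y β, Good (pick (l, s, η)) y β :=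
      ⟨z, γ, by simpa [Good, rank, hσ] using ⟨hzs, hz, hγz, hzl, hcof⟩⟩
    refine ⟨hgood, by simp [rank, hσ], fun n => hsA ?_⟩
    simpa [hσ] using (hyβ _ hgood).1 n

namespace LadderSystem

variable {X W : Type} [LinearOrder W] {S : LadderSystem X W}

theorem not_isLinearlyDSpace (hrank : ∀ b, ∃ p : S.Space, b < S.rank p)
    (hlim : ∀ A : Set S.Space, (∀ b, ∃ a ∈ A, b < S.rank a) →
      ∃ p ∈ S.limits, ∀ n, S.ladder p n ∈ A) : ¬ IsLinearlyDSpace S.Space := by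
  intro h
  obtain ⟨D, hDc, hDd, hD⟩ := h (fun x => {z | S.rank z ≤ S.rank x})
    (fun x => isOpen_rank_le _) (fun x => le_rfl (a := S.rank x)) fun x y =>
      (le_total (S.rank x) (S.rank y)).imp (fun h _ hz => le_trans hz h) fun h _ hz => le_trans hz h
  obtain ⟨p, hp, hpD⟩ := hlim D fun b => by
    obtain ⟨q, hq⟩ := hrank b
    obtain ⟨d, hd, hqd⟩ := mem_iUnion₂.1 (hD.ge (mem_univ q))
    exact ⟨d, hd, hq.trans_le hqd⟩
  have hacc := accPt_of_ladder_mem hp hpD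
  have hpD := isClosed_iff_clusterPt.1 hDc p hacc.clusterPt
  exact hacc.ne (discreteTopology_subtype_iff.1 hDd p hpD)

theorem satisfiesStarStar (hX : #X ≤ 𝔠) (hIic : ∀ a : W, (Iic a).Countable)
    (hlim : ∀ A : Set S.Space, (∀ b, ∃ a ∈ A, b < S.rank a) →
      ∃ (l : W) (D : Set S.Space), #D = 𝔠 ∧
        ∀ p ∈ D, p ∈ S.limits ∧ S.rank p = l ∧ ∀ n, S.ladder p n ∈ A) :
    SatisfiesStarStar S.Space := by
  intro κ hκ hκω A hAκ
  right
  by_cases hA : ∀ b, ∃ a ∈ A, b < S.rank a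
  · obtain ⟨l, D, hDc, hD⟩ := hlim A hA
    obtain ⟨E, hED, hE⟩ := le_mk_iff_exists_subset.1
      (show κ ≤ #D by rw [hDc, ← hAκ]; exact (mk_set_le A).trans hX)
    refine ⟨E, fun p hp => ?_, hE, isClosed_of_rank_eq fun p hp => (hD p (hED hp)).2.1,
      discreteTopology_of_rank_eq fun p hp => (hD p (hED hp)).2.1⟩
    obtain ⟨hpl, -, hpA⟩ := hD p (hED hp)
    exact mem_closure_iff_clusterPt.2 (accPt_of_ladder_mem hpl hpA).clusterPt
  · push Not at hA
    obtain ⟨b, hb⟩ := hA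
    have hcover : A = ⋃ c ∈ Iic b, {p ∈ A | S.rank p = c} := by
      ext p
      simpa using hb p
    obtain ⟨c, hc⟩ : ∃ c, κ ≤ #{p ∈ A | S.rank p = c} := by
      by_contra! h
      have := (card_biUnion_lt_iff_forall_of_isRegular hκ
        ((le_aleph0_iff_set_countable.2 (hIic b)).trans_lt hκω)).2
          fun c (_ : c ∈ Iic b) => h c
      rw [← hcover, hAκ] at this
      exact this.false
    exact ⟨{p ∈ A | S.rank p = c}, (sep_subset _ _).trans subset_closure,
      le_antisymm ((mk_le_mk_of_subset (sep_subset _ _)).trans hAκ.le) hc,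
      isClosed_of_rank_eq fun p hp => hp.2, discreteTopology_of_rank_eq fun p hp => hp.2⟩

end LadderSystem

/-- In ZFC there is a locally countable, locally compact, 0-dimensional `T₂`
space of cardinality `2^ℵ₀` which is not linearly D but satisfies `(**)`. -/
theorem stmt9 :
    ∃ (X : Type) (t : TopologicalSpace X),
      @LocallyCountable X t ∧ @LocallyCompactSpace X t ∧ @ZeroDimensional X t ∧
      @T2Space X t ∧ #X = 2 ^ Cardinal.aleph0 ∧
      ¬@IsLinearlyDSpace X t ∧ @SatisfiesStarStar X t := by
  obtain ⟨W, _, _, hWc, hIic, hW⟩ := exists_linearOrder_omega_one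
  obtain ⟨S, hrank, hS⟩ := exists_ladderSystem hWc hW
  have hmk : #(ℕ → Bool) = 𝔠 := by simp
  refine ⟨S.Space, inferInstance, S.locallyCountable, inferInstance, S.zeroDimensional,
    inferInstance, hmk.trans two_power_aleph0.symm, S.not_isLinearlyDSpace (fun b => ?_) fun A hA => ?_,
    S.satisfiesStarStar hmk.le hIic hS⟩
  · obtain ⟨b', hb'⟩ := hW {b} (countable_singleton b)
    obtain ⟨p, rfl⟩ := hrank b'
    exact ⟨p, hb' b rfl⟩
  · obtain ⟨l, D, hD, h⟩ := hS A hA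
    obtain ⟨p, hp⟩ : D.Nonempty := by
      rw [← nonempty_coe_sort, ← mk_ne_zero_iff, hD]
      exact continuum_ne_zero
    exact ⟨p, (h p hp).1, (h p hp).2.2⟩
end

section
/- Let (N_i)_{i∈ω} be a countable family of infinite subsets of ω. Then there exists a maximal almost disjoint family 𝓜 of infinite subsets of ω with |𝓜| = 2^ℵ⁰ such that |M ∩ N_i| = ℵ₀ for every M ∈ 𝓜 and every i ∈ ω. -/
open Set Cardinal Topology Filter

/-- A countable family of infinite sets of natural numbers has an injective choice function. -/
theorem exists_injective_forall_mem {ι : Type*} [Countable ι] (N : ι → Set ℕ)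
    (hN : ∀ i, (N i).Infinite) : ∃ g : ι → ℕ, g.Injective ∧ ∀ i, g i ∈ N i := by
  rcases isEmpty_or_nonempty ι with h | h
  · exact ⟨fun _ => 0, Function.injective_of_subsingleton _, fun i => h.elim i⟩
  obtain ⟨e, he⟩ := exists_injective_nat ι
  obtain ⟨φ, hφ, hφN⟩ := extraction_forall_of_frequently
    (P := fun n k => k ∈ N (Function.invFun e n))
    fun n => Nat.frequently_atTop_iff_infinite.2 (hN _)
  refine ⟨φ ∘ e, hφ.injective.comp he, fun i => ?_⟩
  simpa [Function.leftInverse_invFun he i] using hφN (e i)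

/-- There is an almost disjoint family indexed by the Cantor space, each member of which meets
every one of countably many given infinite sets in an infinite set. -/
theorem exists_almostDisjoint_cantor (N : ℕ → Set ℕ) (hN : ∀ i, (N i).Infinite) :
    ∃ M : (ℕ → Bool) → Set ℕ, (∀ x y, x ≠ y → (M x ∩ M y).Finite) ∧
      ∀ x i, (M x ∩ N i).Infinite := by
  obtain ⟨g, hg, hgN⟩ := exists_injective_forall_mem
    (fun p : List Bool × ℕ => N p.2) fun p => hN p.2
  refine ⟨fun x => {k | ∃ n, ∃ i ≤ n, g (PiNat.res x n, i) = k}, fun x y hxy => ?_,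
    fun x i => ?_⟩
  · obtain ⟨k, hk⟩ := Function.ne_iff.1 hxy
    refine (((Set.finite_Iic k).prod (Set.finite_Iic k)).image
      fun p : ℕ × ℕ => g (PiNat.res x p.1, p.2)).subset ?_
    rintro _ ⟨⟨n, i, hi, rfl⟩, m, j, -, h⟩
    obtain ⟨hres, -⟩ := Prod.mk.inj (hg h)
    have hmn : m = n := by simpa using congrArg List.length hres
    subst hmn
    have hle : m ≤ k := not_lt.1 fun hlt => hk (PiNat.res_eq_res.1 hres hlt).symm
    exact ⟨(m, i), ⟨hle, hi.trans hle⟩, rfl⟩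
  · have hinj : Function.Injective fun n => g (PiNat.res x (n + i), i) := fun m n h => by
      simpa using congrArg List.length (Prod.mk.inj (hg h)).1
    refine (Set.infinite_range_of_injective hinj).mono ?_
    rintro _ ⟨n, rfl⟩
    exact ⟨⟨n + i, i, Nat.le_add_left i n, rfl⟩, hgN (PiNat.res x (n + i), i)⟩

/-- Every almost disjoint family of infinite sets extends to a maximal one. -/
theorem exists_mad_superset {α : Type*} (S : Set (Set α)) (hinf : ∀ A ∈ S, A.Infinite)
    (had : S.Pairwise fun A B => (A ∩ B).Finite) :
    ∃ T, S ⊆ T ∧ (T.Pairwise fun A B => (A ∩ B).Finite) ∧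
      ∀ A : Set α, A.Infinite → ∃ B ∈ T, (A ∩ B).Infinite := by
  obtain ⟨T, hST, hT⟩ := zorn_subset_nonempty
    {T : Set (Set α) | (∀ A ∈ T, A.Infinite) ∧ T.Pairwise fun A B => (A ∩ B).Finite}
    (fun c hc hchain _ => ⟨⋃₀ c, ⟨fun A ⟨T, hT, hA⟩ => (hc hT).1 A hA,
      (Set.pairwise_sUnion hchain.directedOn).2 fun T hT => (hc hT).2⟩,
      fun _ => Set.subset_sUnion_of_mem⟩) S ⟨hinf, had⟩
  refine ⟨T, hST, hT.prop.2, fun A hA => ?_⟩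
  by_contra! hfin
  have hins : insert A T ⊆ T := hT.le_of_ge
    ⟨by simpa [hA] using hT.prop.1, hT.prop.2.insert fun B hB _ =>
      ⟨hfin B hB, Set.inter_comm A B ▸ hfin B hB⟩⟩ (Set.subset_insert A T)
  exact hA (by simpa using hfin A (hins (Set.mem_insert A T)))

/-- For any countable family `(N i)` of infinite subsets of `ω` there is a MAD
family `𝓜` of size `2^ℵ₀` each member of which has infinite intersection with
every `N i`. -/
theorem stmt12 (N : ℕ → Set ℕ) (hN : ∀ i, (N i).Infinite) :
    ∃ 𝓜 : Set (Set ℕ),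
      (∀ M ∈ 𝓜, M.Infinite) ∧
      (∀ M ∈ 𝓜, ∀ M' ∈ 𝓜, M ≠ M' → (M ∩ M').Finite) ∧
      (∀ A : Set ℕ, A.Infinite → ∃ M ∈ 𝓜, (A ∩ M).Infinite) ∧
      #↥𝓜 = 2 ^ Cardinal.aleph0 ∧
      ∀ M ∈ 𝓜, ∀ i : ℕ, (M ∩ N i).Infinite := by
  classical
  obtain ⟨M, hM, hMN⟩ := exists_almostDisjoint_cantor N hN
  have hMinf : ∀ x, (M x).Infinite := fun x => (hMN x 0).mono Set.inter_subset_left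
  obtain ⟨T, hMT, hT, hTmax⟩ := exists_mad_superset (Set.range M)
    (Set.forall_mem_range.2 hMinf) (by
      rintro _ ⟨x, rfl⟩ _ ⟨y, rfl⟩ h
      exact hM x y fun hxy => h (congrArg M hxy))
  -- Attach every additional member `B` of `T` to its own `M x`, namely at `x = χ B`.
  let χ : Set ℕ → ℕ → Bool := fun B n => decide (n ∈ B)
  let D : (ℕ → Bool) → Set ℕ := fun x => {n | x n = true}
  have hDχ : ∀ B, D (χ B) = B := fun B => by ext; simp [D, χ]
  have hDinj : Function.Injective D := fun x y h => funext fun n =>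
    Bool.eq_iff_iff.2 (Set.ext_iff.1 h n)
  let E : (ℕ → Bool) → Set ℕ := fun x => if D x ∈ T \ Set.range M then D x else ∅
  let K : (ℕ → Bool) → Set ℕ := fun x => M x ∪ E x
  have hME : ∀ x y, (M x ∩ E y).Finite := fun x y => by
    by_cases h : D y ∈ T \ Set.range M
    · simpa only [E, if_pos h] using
        hT (hMT ⟨x, rfl⟩) h.1 fun hxy => h.2 ⟨x, hxy⟩
    · simp only [E, if_neg h, Set.inter_empty, Set.finite_empty]
  have hE : ∀ x y, x ≠ y → (E x ∩ E y).Finite := fun x y hxy => by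
    by_cases hx : D x ∈ T \ Set.range M
    · by_cases hy : D y ∈ T \ Set.range M
      · simpa only [E, if_pos hx, if_pos hy] using hT hx.1 hy.1 (hDinj.ne hxy)
      · simp only [E, if_neg hy, Set.inter_empty, Set.finite_empty]
    · simp only [E, if_neg hx, Set.empty_inter, Set.finite_empty]
  have hK : ∀ x y, x ≠ y → (K x ∩ K y).Finite := fun x y hxy => by
    simp only [K, Set.union_inter_distrib_right, Set.inter_union_distrib_left]
    exact ((hM x y hxy).union (Set.inter_comm (M y) (E x) ▸ hME y x)).union
      ((hME x y).union (hE x y hxy)) |>.subset (by grind)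
  have hKinf : ∀ x, (K x).Infinite := fun x => (hMinf x).mono Set.subset_union_left
  have hKinj : Function.Injective K := fun x y h => by
    by_contra hxy
    have hfin := hK x y hxy
    rw [← h, Set.inter_self] at hfin
    exact hKinf x hfin
  refine ⟨Set.range K, Set.forall_mem_range.2 hKinf, ?_, fun A hA => ?_, ?_, ?_⟩
  · rintro _ ⟨x, rfl⟩ _ ⟨y, rfl⟩ h
    exact hK x y fun hxy => h (congrArg K hxy)
  · obtain ⟨B, hB, hAB⟩ := hTmax A hA
    by_cases hBM : B ∈ Set.range M
    · obtain ⟨x, rfl⟩ := hBM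
      exact ⟨K x, ⟨x, rfl⟩, hAB.mono (Set.inter_subset_inter_right A Set.subset_union_left)⟩
    · have hEB : E (χ B) = B := by
        simp only [E, hDχ]
        exact if_pos ⟨hB, hBM⟩
      refine ⟨K (χ B), ⟨χ B, rfl⟩, hAB.mono (Set.inter_subset_inter_right A ?_)⟩
      exact hEB.symm.subset.trans Set.subset_union_right
  · rw [Cardinal.mk_range_eq K hKinj]
    simp
  · rintro _ ⟨x, rfl⟩ i
    exact (hMN x i).mono (Set.inter_subset_inter_left _ Set.subset_union_left)
end

section
/- Let T and S be disjoint sets, r a point not in T ∪ S, and τ a topology on T ∪ S such that (T ∪ S, τ) is a locally countable, locally compact, 0-dimensional T₂ space, T is open in (T ∪ S, τ), and S is countable. Let D = {d_n : n ∈ ω} ⊆ T be a set that is closed and discrete in (T ∪ S, τ) and completely discrete in T, i.e. there exists a family {G_n : n ∈ ω} of open sets with d_n ∈ G_n which is discrete in the subspace T (every point of T has a neighborhood meeting at most one G_n). Then there is a topology ρ on R = T ∪ S ∪ {r} such that: (R, ρ) is locally countable, locally compact, 0-dimensional and T₂; the subspace topology induced by ρ on T ∪ S equals τ; the sequence D converges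 to r in (R, ρ); and r does not belong to the ρ-closure of S. -/
open Set Cardinal Topology Filter

/-- The topology on `α` making `f` an open embedding (when `f` is injective and misses `r`) and
in which the sets containing `r` and all but finitely many of the `f '' K n` are the
neighborhoods of `r`. -/
abbrev adjoinLimitTopology {X α : Type*} [TopologicalSpace X] (f : X → α) (r : α) (K : ℕ → Set X) :
    TopologicalSpace α where
  IsOpen U := IsOpen (f ⁻¹' U) ∧ (r ∈ U → ∀ᶠ n in atTop, K n ⊆ f ⁻¹' U)
  isOpen_univ := by simp
  isOpen_inter U V hU hV :=
    ⟨hU.1.inter hV.1, fun h => by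
      filter_upwards [hU.2 h.1, hV.2 h.2] with n h1 h2 using subset_inter h1 h2⟩
  isOpen_sUnion s hs := by
    refine ⟨?_, ?_⟩
    · rw [preimage_sUnion]
      exact isOpen_biUnion fun U hU => (hs U hU).1
    · rintro ⟨U, hU, hrU⟩
      filter_upwards [(hs U hU).2 hrU] with n hn
      exact hn.trans (preimage_mono (subset_sUnion_of_mem hU))

/-- The topology of `α` is the one of `adjoinLimitTopology f r K`, where `f` is a bijection onto
the complement of `r`. -/
structure IsLimitExtension {X α : Type*} [TopologicalSpace X] [TopologicalSpace α] (f : X → α)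
    (r : α) (K : ℕ → Set X) : Prop where
  injective : Function.Injective f
  range_eq : range f = {r}ᶜ
  isOpen_iff : ∀ U : Set α,
    IsOpen U ↔ IsOpen (f ⁻¹' U) ∧ (r ∈ U → ∀ᶠ n in atTop, K n ⊆ f ⁻¹' U)

/-- In a locally compact 0-dimensional Hausdorff space the compact clopen sets form a base. -/
theorem ZeroDimensional.exists_isCompact_isClopen {X : Type*} [TopologicalSpace X] [T2Space X]
    [LocallyCompactSpace X] (h0 : ZeroDimensional X) {x : X} {U : Set X} (hU : U ∈ 𝓝 x) :
    ∃ V, IsCompact V ∧ IsClopen V ∧ x ∈ V ∧ V ⊆ U := by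
  obtain ⟨C, hC, hCU, hCc⟩ := local_compact_nhds hU
  obtain ⟨V, hV, hxV, hVC⟩ := h0 x (interior C) isOpen_interior (mem_interior_iff_mem_nhds.2 hC)
  have hVC' := hVC.trans interior_subset
  exact ⟨V, hCc.of_isClosed_subset hV.1 hVC', hV, hxV, hVC'.trans hCU⟩

namespace IsLimitExtension

variable {X α : Type*} [TopologicalSpace X] [TopologicalSpace α] {f : X → α} {r : α}
  {K : ℕ → Set X}

theorem apply_ne (h : IsLimitExtension f r K) (x : X) : f x ≠ r := by
  have : f x ∈ ({r}ᶜ : Set α) := h.range_eq ▸ mem_range_self x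
  exact this

theorem notMem_image (h : IsLimitExtension f r K) (V : Set X) : r ∉ f '' V := by
  rintro ⟨x, -, hx⟩
  exact h.apply_ne x hx

theorem eq_or_exists (h : IsLimitExtension f r K) (y : α) : y = r ∨ ∃ x, f x = y := by
  by_cases hy : y = r
  · exact Or.inl hy
  · exact Or.inr (h.range_eq ▸ (hy : y ∈ ({r}ᶜ : Set α)) : y ∈ range f)

theorem isOpen_image (h : IsLimitExtension f r K) {V : Set X} (hV : IsOpen V) :
    IsOpen (f '' V) := by
  rw [h.isOpen_iff, preimage_image_eq _ h.injective]
  exact ⟨hV, fun hr => (h.notMem_image V hr).elim⟩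

theorem isOpenEmbedding (h : IsLimitExtension f r K) : IsOpenEmbedding f :=
  .of_continuous_injective_isOpenMap ⟨fun _ hU => ((h.isOpen_iff _).1 hU).1⟩ h.injective
    fun _ hV => h.isOpen_image hV

theorem isClopen_image (h : IsLimitExtension f r K) (hK : LocallyFinite K) {V : Set X}
    (hV : IsClopen V) (hVc : IsCompact V) : IsClopen (f '' V) := by
  refine ⟨⟨?_⟩, h.isOpen_image hV.2⟩
  rw [h.isOpen_iff, preimage_compl, preimage_image_eq _ h.injective]
  refine ⟨hV.1.isOpen_compl, fun _ => ?_⟩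
  have hfin := hK.finite_nonempty_inter_compact hVc
  rw [← Nat.cofinite_eq_atTop]
  filter_upwards [hfin.compl_mem_cofinite] with n hn x hx hxV
  exact hn ⟨x, hx, hxV⟩

theorem isClopen_insert (h : IsLimitExtension f r K) (hK : LocallyFinite K)
    (hKc : ∀ n, IsClopen (K n)) (m : ℕ) : IsClopen (insert r (f '' ⋃ n, K (m + n))) := by
  have hpre : f ⁻¹' insert r (f '' ⋃ n, K (m + n)) = ⋃ n, K (m + n) := by
    ext x
    simp [h.apply_ne x, h.injective.eq_iff]
  refine ⟨⟨?_⟩, ?_⟩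
  · rw [h.isOpen_iff, preimage_compl, hpre]
    refine ⟨IsClosed.isOpen_compl (self := ?_), fun hr => (hr (mem_insert _ _)).elim⟩
    exact (hK.comp_injective (add_right_injective m)).isClosed_iUnion fun n => (hKc _).1
  · rw [h.isOpen_iff, hpre]
    refine ⟨isOpen_iUnion fun n => (hKc _).2, fun _ => ?_⟩
    filter_upwards [eventually_ge_atTop m] with n hn
    obtain ⟨k, rfl⟩ := Nat.exists_eq_add_of_le hn
    exact subset_iUnion (fun n => K (m + n)) k

theorem exists_insert_subset (h : IsLimitExtension f r K) {U : Set α} (hU : IsOpen U)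
    (hr : r ∈ U) : ∃ m, insert r (f '' ⋃ n, K (m + n)) ⊆ U := by
  obtain ⟨m, hm⟩ := eventually_atTop.1 (((h.isOpen_iff U).1 hU).2 hr)
  refine ⟨m, insert_subset hr ?_⟩
  rw [image_subset_iff]
  exact iUnion_subset fun n => hm _ (Nat.le_add_right m n)

theorem isCompact_insert (h : IsLimitExtension f r K) (hK : ∀ n, IsCompact (K n)) :
    IsCompact (insert r (f '' ⋃ n, K n)) := by
  rw [isCompact_iff_ultrafilter_le_nhds]
  intro F hF
  by_cases hFr : (F : Filter α) ≤ 𝓝 r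
  · exact ⟨r, mem_insert _ _, hFr⟩
  obtain ⟨U, ⟨hrU, hU⟩, hUF⟩ : ∃ U, (r ∈ U ∧ IsOpen U) ∧ U ∉ F := by
    simpa [(nhds_basis_opens r).ge_iff, and_assoc] using hFr
  obtain ⟨m, hm⟩ := eventually_atTop.1 (((h.isOpen_iff U).1 hU).2 hrU)
  have hc : IsCompact (f '' ⋃ n ∈ Finset.range m, K n) :=
    ((Finset.range m).isCompact_biUnion fun n _ => hK n).image h.isOpenEmbedding.continuous
  have hmem : f '' ⋃ n ∈ Finset.range m, K n ∈ F := by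
    filter_upwards [le_principal_iff.1 hF, Ultrafilter.compl_mem_iff_notMem.2 hUF] with y hy hyU
    rcases hy with rfl | ⟨x, hx, rfl⟩
    · exact (hyU hrU).elim
    obtain ⟨n, hn⟩ := mem_iUnion.1 hx
    refine mem_image_of_mem f (mem_biUnion (Finset.mem_coe.2 (Finset.mem_range.2 ?_)) hn)
    by_contra! hmn
    exact hyU (hm n hmn hn)
  obtain ⟨y, hy, hFy⟩ := isCompact_iff_ultrafilter_le_nhds.1 hc F (le_principal_iff.2 hmem)
  refine ⟨y, mem_insert_of_mem _ (image_mono ?_ hy), hFy⟩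
  exact iUnion₂_subset fun n _ => subset_iUnion K n

theorem locallyCountable (h : IsLimitExtension f r K) (hX : LocallyCountable X)
    (hK : LocallyFinite K) (hKc : ∀ n, IsClopen (K n)) (hKcount : ∀ n, (K n).Countable) :
    LocallyCountable α := by
  intro y
  rcases h.eq_or_exists y with rfl | ⟨x, rfl⟩
  · exact ⟨_, (h.isClopen_insert hK hKc 0).2.mem_nhds (mem_insert _ _),
      ((countable_iUnion fun n => hKcount _).image f).insert _⟩
  · obtain ⟨U, hU, hUc⟩ := hX x
    exact ⟨f '' U, h.isOpenEmbedding.image_mem_nhds.2 hU, hUc.image f⟩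

theorem zeroDimensional (h : IsLimitExtension f r K) [T2Space X] [LocallyCompactSpace X]
    (h0 : ZeroDimensional X) (hK : LocallyFinite K) (hKc : ∀ n, IsClopen (K n)) :
    ZeroDimensional α := by
  intro y U hU hy
  rcases h.eq_or_exists y with rfl | ⟨x, rfl⟩
  · obtain ⟨m, hm⟩ := h.exists_insert_subset hU hy
    exact ⟨_, h.isClopen_insert hK hKc m, mem_insert _ _, hm⟩
  · obtain ⟨V, hVc, hV, hxV, hVU⟩ := h0.exists_isCompact_isClopen
      ((hU.preimage h.isOpenEmbedding.continuous).mem_nhds hy)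
    exact ⟨f '' V, h.isClopen_image hK hV hVc, mem_image_of_mem f hxV, image_subset_iff.2 hVU⟩

theorem t2Space (h : IsLimitExtension f r K) [T1Space X] (h0 : ZeroDimensional α) :
    T2Space α := by
  have sep : ∀ (x : X) (y : α), f x ≠ y →
      ∃ V : Set α, IsClopen V ∧ f x ∈ V ∧ y ∉ V := by
    intro x y hxy
    have hcl : IsClosed (f ⁻¹' {y}) :=
      (subsingleton_singleton.preimage h.injective).isClosed
    obtain ⟨V, hV, hxV, hVU⟩ := h0 (f x) _ (h.isOpen_image hcl.isOpen_compl)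
      (mem_image_of_mem f hxy)
    refine ⟨V, hV, hxV, fun hyV => ?_⟩
    obtain ⟨z, hz, hzy⟩ := hVU hyV
    exact hz hzy
  refine ⟨fun y z hyz => ?_⟩
  rcases h.eq_or_exists y with rfl | ⟨x, rfl⟩
  · rcases h.eq_or_exists z with rfl | ⟨x, rfl⟩
    · exact (hyz rfl).elim
    · obtain ⟨V, hV, hxV, hyV⟩ := sep x _ hyz.symm
      exact ⟨Vᶜ, V, hV.compl.2, hV.2, hyV, hxV, disjoint_compl_left⟩
  · obtain ⟨V, hV, hxV, hyV⟩ := sep x _ hyz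
    exact ⟨V, Vᶜ, hV.2, hV.compl.2, hxV, hyV, disjoint_compl_right⟩

theorem locallyCompactSpace (h : IsLimitExtension f r K) [LocallyCompactSpace X] [T2Space α]
    (hK : LocallyFinite K) (hKc : ∀ n, IsClopen (K n)) (hKcomp : ∀ n, IsCompact (K n)) :
    LocallyCompactSpace α := by
  have : WeaklyLocallyCompactSpace α := by
    refine ⟨fun y => ?_⟩
    rcases h.eq_or_exists y with rfl | ⟨x, rfl⟩
    · refine ⟨_, h.isCompact_insert hKcomp, ?_⟩
      simpa using (h.isClopen_insert hK hKc 0).2.mem_nhds (mem_insert _ _)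
    · obtain ⟨C, hC, hCx⟩ := exists_compact_mem_nhds x
      exact ⟨f '' C, hC.image h.isOpenEmbedding.continuous,
        h.isOpenEmbedding.image_mem_nhds.2 hCx⟩
  infer_instance

theorem tendsto (h : IsLimitExtension f r K) {d : ℕ → X} (hd : ∀ n, d n ∈ K n) :
    Tendsto (fun n => f (d n)) atTop (𝓝 r) := by
  refine (nhds_basis_opens r).tendsto_right_iff.2 fun U hU => ?_
  filter_upwards [((h.isOpen_iff U).1 hU.2).2 hU.1] with n hn using hn (hd n)

theorem notMem_closure (h : IsLimitExtension f r K) (hK : LocallyFinite K)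
    (hKc : ∀ n, IsClopen (K n)) {S : Set α} (hr : r ∉ S) (hS : ∀ n, Disjoint (f '' K n) S) :
    r ∉ closure S := by
  intro hcl
  obtain ⟨y, hy, hyS⟩ := mem_closure_iff.1 hcl _ (h.isClopen_insert hK hKc 0).2 (mem_insert _ _)
  rcases hy with rfl | ⟨x, hx, rfl⟩
  · exact hr hyS
  · obtain ⟨n, hn⟩ := mem_iUnion.1 hx
    exact (hS _).le_bot ⟨mem_image_of_mem f hn, hyS⟩

end IsLimitExtension

/-- A sequence with closed range in a locally countable, locally compact, 0-dimensional Hausdorff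
space, expanded by a family of open sets that is locally finite at all points of the open set `T`
with countable complement, has a locally finite expansion by countable compact clopen subsets
of `T`. -/
theorem exists_locallyFinite_isCompact_isClopen {X : Type*} [TopologicalSpace X] [T2Space X]
    [LocallyCompactSpace X] (hlc : LocallyCountable X) (h0 : ZeroDimensional X) {T : Set X}
    (hT : IsOpen T) (hTc : Tᶜ.Countable) {d : ℕ → X} (hdT : ∀ n, d n ∈ T)
    (hd : IsClosed (range d)) {G : ℕ → Set X} (hG : ∀ n, IsOpen (G n)) (hdG : ∀ n, d n ∈ G n)
    (hGfin : ∀ x ∈ T, ∃ V ∈ 𝓝 x, {n | (G n ∩ V).Nonempty}.Finite) :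
    ∃ K : ℕ → Set X, LocallyFinite K ∧ (∀ n, IsClopen (K n)) ∧ (∀ n, IsCompact (K n)) ∧
      (∀ n, (K n).Countable) ∧ (∀ n, K n ⊆ T) ∧ ∀ n, d n ∈ K n := by
  have hW : ∀ x : X, ∃ W : Set X, IsClopen W ∧ Disjoint W (range d) ∧ (x ∉ T → x ∈ W) := by
    intro x
    by_cases hx : x ∈ T
    · exact ⟨∅, isClopen_empty, empty_disjoint _, fun h => (h hx).elim⟩
    · obtain ⟨W, hW, hxW, hWd⟩ := h0 x (range d)ᶜ hd.isOpen_compl (by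
        rintro ⟨n, rfl⟩
        exact hx (hdT n))
      exact ⟨W, hW, disjoint_left.2 fun y hy => hWd hy, fun _ => hxW⟩
  choose W hWc hWd hxW using hW
  have := hTc.to_subtype
  obtain ⟨e, he⟩ := exists_injective_nat (Tᶜ : Set X)
  have hK : ∀ n, ∃ V, IsCompact V ∧ IsClopen V ∧ d n ∈ V ∧ V.Countable ∧ V ⊆ T ∧ V ⊆ G n ∧
      ∀ s : (Tᶜ : Set X), e s ≤ n → Disjoint V (W s) := by
    intro n
    obtain ⟨C, hC, hCc⟩ := hlc (d n)
    have hfin : {s : (Tᶜ : Set X) | e s ≤ n}.Finite :=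
      (finite_Iic n).preimage he.injOn
    have hA : (⋃ s ∈ {s : (Tᶜ : Set X) | e s ≤ n}, W s)ᶜ ∈ 𝓝 (d n) := by
      refine (hfin.isClosed_biUnion fun s _ => (hWc s).1).isOpen_compl.mem_nhds ?_
      simp only [mem_compl_iff, mem_iUnion, not_exists]
      exact fun s _ hs => disjoint_left.1 (hWd s) hs (mem_range_self n)
    obtain ⟨V, hVc, hV, hdV, hVU⟩ := h0.exists_isCompact_isClopen (inter_mem
      (inter_mem hC (hT.mem_nhds (hdT n))) (inter_mem ((hG n).mem_nhds (hdG n)) hA))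
    refine ⟨V, hVc, hV, hdV, hCc.mono fun x hx => (hVU hx).1.1, fun x hx => (hVU hx).1.2,
      fun x hx => (hVU hx).2.1, fun s hs => disjoint_left.2 fun x hx hxs => ?_⟩
    exact (hVU hx).2.2 (mem_biUnion (show s ∈ {s | e s ≤ n} from hs) hxs)
  choose K hKcomp hKc hdK hKcount hKT hKG hKW using hK
  refine ⟨K, fun x => ?_, hKc, hKcomp, hKcount, hKT, hdK⟩
  by_cases hx : x ∈ T
  · obtain ⟨V, hV, hfin⟩ := hGfin x hx
    exact ⟨V, hV, hfin.subset fun n hn => hn.mono (inter_subset_inter_left _ (hKG n))⟩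
  · refine ⟨W x, (hWc x).2.mem_nhds (hxW x hx), (finite_lt_nat (e ⟨x, hx⟩)).subset ?_⟩
    rintro n ⟨y, hyK, hyW⟩
    by_contra hn
    exact disjoint_left.1 (hKW n ⟨x, hx⟩ (not_lt.1 hn)) hyK hyW

/-- The topology extension lemma: a point `r` can be added to a locally
countable, locally compact, 0-dimensional `T₂` space `T ∪ S` (with `T` open and
`S` countable) in such a way that a prescribed set `D ⊆ T`, closed discrete in
`T ∪ S` and completely discrete in `T`, converges to `r`, while `r` is not in
the closure of `S`; the new space is again locally countable, locally compact,
0-dimensional and `T₂`, and induces the original topology on `T ∪ S`. -/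
theorem stmt13 {α : Type*} (T S : Set α) (r : α)
    (hdisj : Disjoint T S) (hr : r ∉ T ∪ S) (hcover : insert r (T ∪ S) = Set.univ)
    (τ : TopologicalSpace ↥(T ∪ S))
    (hT2 : @T2Space ↥(T ∪ S) τ) (hlc : @LocallyCountable ↥(T ∪ S) τ)
    (hlcp : @LocallyCompactSpace ↥(T ∪ S) τ) (h0 : @ZeroDimensional ↥(T ∪ S) τ)
    (hTopen : @IsOpen ↥(T ∪ S) τ {x : ↥(T ∪ S) | (x : α) ∈ T})
    (hS : S.Countable)
    (d : ℕ → ↥(T ∪ S)) (hdT : ∀ n, (d n : α) ∈ T)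
    (hclosed : @IsClosed ↥(T ∪ S) τ (Set.range d))
    (hdiscr : @DiscreteTopology ↥(Set.range d) (TopologicalSpace.induced Subtype.val τ))
    (G : ℕ → Set ↥(T ∪ S)) (hGopen : ∀ n, @IsOpen ↥(T ∪ S) τ (G n))
    (hdG : ∀ n, d n ∈ G n)
    (hGdiscr : ∀ x : ↥(T ∪ S), (x : α) ∈ T → ∃ V : Set ↥(T ∪ S),
      @IsOpen ↥(T ∪ S) τ V ∧ x ∈ V ∧ {n : ℕ | (V ∩ G n).Nonempty}.Subsingleton) :
    ∃ ρ : TopologicalSpace α,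
      TopologicalSpace.induced (Subtype.val : ↥(T ∪ S) → α) ρ = τ ∧
      @LocallyCountable α ρ ∧ @LocallyCompactSpace α ρ ∧ @ZeroDimensional α ρ ∧
      @T2Space α ρ ∧
      Filter.Tendsto (fun n => (d n : α)) Filter.atTop (@nhds α ρ r) ∧
      r ∉ @closure α ρ S := by
  have hTc : ({x : ↥(T ∪ S) | (x : α) ∈ T}ᶜ).Countable :=
    (hS.preimage Subtype.val_injective).mono fun x hx => x.2.resolve_left hx
  obtain ⟨K, hK, hKc, hKcomp, hKcount, hKT, hdK⟩ :=
    exists_locallyFinite_isCompact_isClopen hlc h0 hTopen hTc hdT hclosed hGopen hdG (by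
      intro x hx
      obtain ⟨V, hV, hxV, hsub⟩ := hGdiscr x hx
      refine ⟨V, hV.mem_nhds hxV, ?_⟩
      simpa only [inter_comm V] using hsub.finite)
  let ρ : TopologicalSpace α := adjoinLimitTopology (Subtype.val : ↥(T ∪ S) → α) r K
  have h : IsLimitExtension (Subtype.val : ↥(T ∪ S) → α) r K := by
    refine ⟨Subtype.val_injective, ?_, fun U => Iff.rfl⟩
    rw [Subtype.range_coe]
    ext x
    have hx : x ∈ insert r (T ∪ S) := hcover ▸ mem_univ x
    exact ⟨fun hx' hxr => hr (hxr ▸ hx'), fun hxr => hx.resolve_left hxr⟩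
  have hzero := h.zeroDimensional h0 hK hKc
  have ht2 := h.t2Space hzero
  refine ⟨ρ, h.isOpenEmbedding.eq_induced.symm, h.locallyCountable hlc hK hKc hKcount,
    h.locallyCompactSpace hK hKc hKcomp, hzero, ht2, h.tendsto hdK,
    h.notMem_closure hK hKc (fun hrS => hr (Or.inr hrS)) fun n => ?_⟩
  refine hdisj.mono_left ?_
  rintro _ ⟨x, hx, rfl⟩
  exact hKT n hx
end

section
/- Assume Martin's Axiom. Then every locally countable, locally compact Hausdorff space X of cardinality strictly less than 2^ℵ⁰ is a D-space if and only if it is an aD-space. -/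
open Set Cardinal Topology Filter

/-- `X` is an *aD-space*: for every closed `F ⊆ X` and every open cover `𝓤` of
`X` there are a set `A ⊆ F` closed and discrete in `X` and an assignment
`φ` with `φ a ∈ 𝓤`, `a ∈ φ a` for `a ∈ A`, such that `F ⊆ ⋃_{a ∈ A} φ a`. -/
def IsADSpace (X : Type*) [TopologicalSpace X] : Prop :=
  ∀ F : Set X, IsClosed F → ∀ 𝓤 : Set (Set X), (∀ u ∈ 𝓤, IsOpen u) → ⋃₀ 𝓤 = Set.univ →
    ∃ A : Set X, A ⊆ F ∧ IsClosed A ∧ DiscreteTopology ↥A ∧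
      ∃ φ : X → Set X, (∀ a ∈ A, φ a ∈ 𝓤 ∧ a ∈ φ a) ∧ F ⊆ ⋃ a ∈ A, φ a

/-- `Y` is *countably tight*: a set containing the closures of all its countable subsets
is closed. -/
def CountablyTight (Y : Type*) [TopologicalSpace Y] : Prop :=
  ∀ T : Set Y, (∀ E ⊆ T, E.Countable → closure E ⊆ T) → IsClosed T

section CountablyTight

variable {Y Z : Type*} [TopologicalSpace Y] [TopologicalSpace Z]

theorem CountablyTight.of_homeomorph (h : CountablyTight Y) (e : Y ≃ₜ Z) : CountablyTight Z := by
  intro T hT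
  rw [← e.isClosed_preimage]
  refine h _ fun E hE hc => ?_
  rw [← image_subset_iff, e.image_closure]
  exact hT _ (image_subset_iff.2 hE) (hc.image e)

theorem CountablyTight.of_subsingleton [Subsingleton Y] : CountablyTight Y := fun T _ => by
  rcases T.eq_empty_or_nonempty with rfl | ⟨y, hy⟩
  · exact isClosed_empty
  · rw [Subsingleton.eq_univ_of_nonempty ⟨y, hy⟩]
    exact isClosed_univ

theorem CountablyTight.prod [CompactSpace Y] [T2Space Y] [CompactSpace Z] [T2Space Z]
    (hY : CountablyTight Y) (hZ : CountablyTight Z) : CountablyTight (Y × Z) := by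
  intro T hT
  rw [← closure_subset_iff_isClosed]
  rintro ⟨a, b⟩ hab
  by_contra hnot
  have hS : IsClosed {y : Y | (y, b) ∈ T} := by
    refine hY _ fun E hE hc y hy => ?_
    refine hT ((fun y => (y, b)) '' E) (image_subset_iff.2 hE) (hc.image _) ?_
    exact image_closure_subset_closure_image (by fun_prop) (mem_image_of_mem _ hy)
  obtain ⟨N, hNa, hNc, hN⟩ := exists_mem_nhds_isClosed_subset (hS.isOpen_compl.mem_nhds hnot)
  have hclosed : IsClosed (Prod.snd '' (T ∩ Prod.fst ⁻¹' N)) := by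
    refine hZ _ fun E hE hc => ?_
    obtain ⟨E', hE', hbij⟩ := SurjOn.exists_bijOn_subset hE
    have hc' : E'.Countable := countable_of_injective_of_countable_image hbij.injOn
      (hbij.image_eq.symm ▸ hc)
    have h1 : closure E' ⊆ T ∩ Prod.fst ⁻¹' N :=
      subset_inter (hT E' (fun p hp => (hE' hp).1) hc')
        (closure_minimal (fun p hp => (hE' hp).2) (hNc.preimage continuous_fst))
    refine (closure_minimal ?_ ((isClosed_closure (s := E')).isCompact.image
      continuous_snd).isClosed).trans (image_mono h1)
    rw [← hbij.image_eq]
    exact image_mono subset_closure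
  have hb : b ∈ Prod.snd '' (T ∩ Prod.fst ⁻¹' N) := by
    rw [← hclosed.closure_eq]
    have hmem : (a, b) ∈ closure (T ∩ Prod.fst ⁻¹' N) := by
      rw [mem_closure_iff_nhds] at hab ⊢
      intro s hs
      obtain ⟨p, ⟨hp1, hp2⟩, hp3⟩ :=
        hab (s ∩ Prod.fst ⁻¹' N) (inter_mem hs (continuous_fst.continuousAt hNa))
      exact ⟨p, hp1, hp3, hp2⟩
    exact image_closure_subset_closure_image continuous_snd (mem_image_of_mem _ hmem)
  obtain ⟨⟨y, z⟩, ⟨hyT, hyN⟩, rfl⟩ := hb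
  exact hN hyN hyT

theorem CountablyTight.pi_fin [CompactSpace Y] [T2Space Y] (hY : CountablyTight Y) (n : ℕ) :
    CountablyTight (Fin n → Y) := by
  induction n with
  | zero => exact .of_subsingleton
  | succ n ih =>
    exact (ih.prod (hY.of_homeomorph (Homeomorph.funUnique (Fin 1) Y).symm)).of_homeomorph
      (Fin.appendHomeomorph n 1)

/-- In a compact countably tight space there is no uncountable family of points which is
separated by clopen sets in the manner of a free sequence. -/
theorem CountablyTight.countable_of_clopen [CompactSpace Y] (hY : CountablyTight Y)
    {ι : Type*} (Q : Set ι) (a : ι → Y) (W : ι → Set Y) (hW : ∀ q ∈ Q, IsClopen (W q))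
    (h : ∀ p ∈ Q, {q ∈ Q | ¬(a p ∈ W q ∧ a q ∉ W p)}.Countable) : Q.Countable := by
  by_contra hQ
  set T : Set Y := {y | ∃ S ⊆ Q, S.Countable ∧ y ∈ closure (a '' S)} with hTdef
  have hT : IsClosed T := by
    refine hY T fun E hE hc => ?_
    have hE' : ∀ e ∈ E, ∃ S ⊆ Q, S.Countable ∧ e ∈ closure (a '' S) := fun e he => hE he
    choose! S hSQ hSc hS using hE'
    intro y hy
    refine ⟨⋃ e ∈ E, S e, iUnion₂_subset hSQ, hc.biUnion hSc, ?_⟩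
    refine closure_minimal (fun e he => ?_) isClosed_closure hy
    exact closure_mono (image_mono (subset_biUnion_of_mem he)) (hS e he)
  have hcover : T ⊆ ⋃ q ∈ Q, W q := by
    rintro y ⟨S, hSQ, hSc, hy⟩
    have hbad : (⋃ p ∈ S, {q ∈ Q | ¬(a p ∈ W q ∧ a q ∉ W p)}).Countable :=
      hSc.biUnion fun p hp => h p (hSQ hp)
    obtain ⟨q, hqQ, hq⟩ := not_subset.1 fun hsub => hQ (hbad.mono hsub)
    refine mem_biUnion hqQ (closure_minimal ?_ (hW q hqQ).isClosed hy)
    rintro _ ⟨p, hp, rfl⟩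
    by_contra hpq
    exact hq (mem_biUnion hp ⟨hqQ, fun hh => hpq hh.1⟩)
  obtain ⟨t, htQ, htf, ht⟩ := hT.isCompact.elim_finite_subcover_image
    (fun q hq => (hW q hq).isOpen) hcover
  have hbad : (⋃ p ∈ t, {q ∈ Q | ¬(a p ∈ W q ∧ a q ∉ W p)}).Countable :=
    htf.countable.biUnion fun p hp => h p (htQ hp)
  obtain ⟨q, hqQ, hq⟩ := not_subset.1 fun hsub => hQ (hbad.mono hsub)
  have hqT : a q ∈ T := ⟨{q}, singleton_subset_iff.2 hqQ, countable_singleton q,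
    subset_closure ⟨q, rfl, rfl⟩⟩
  obtain ⟨p, hp, hpq⟩ := mem_iUnion₂.1 (ht hqT)
  exact hq (mem_biUnion hp ⟨hqQ, fun hh => hh.2 hpq⟩)

end CountablyTight

section LocallyFinite

variable {X : Type*} [TopologicalSpace X]

theorem isClosed_and_discreteTopology_iff_s17 {D : Set X} :
    IsClosed D ∧ DiscreteTopology D ↔ ∀ x, Disjoint (𝓝[≠] x) (𝓟 D) := by
  rw [← isDiscrete_iff_discreteTopology, isClosed_and_discrete_iff]

theorem isClosed_and_discreteTopology_of_finite_inter [T1Space X] {D : Set X}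
    (h : ∀ x, ∃ N ∈ 𝓝 x, (N ∩ D).Finite) : IsClosed D ∧ DiscreteTopology D := by
  rw [isClosed_and_discreteTopology_iff_s17]
  intro x
  obtain ⟨N, hN, hfin⟩ := h x
  rw [disjoint_principal_right]
  filter_upwards [nhdsWithin_le_nhds hN,
    nhdsWithin_le_nhds ((hfin.subset (sdiff_subset (t := {x}))).isClosed.isOpen_compl.mem_nhds
      fun hx => hx.2 rfl), self_mem_nhdsWithin] with y hyN hy hyx hyD
  exact hy ⟨⟨hyN, hyD⟩, hyx⟩

theorem isClosed_and_discreteTopology_subset {A B : Set X} (hA : IsClosed A)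
    (hd : DiscreteTopology A) (hBA : B ⊆ A) : IsClosed B ∧ DiscreteTopology B := by
  have h := isClosed_and_discreteTopology_iff_s17.1 ⟨hA, hd⟩
  exact isClosed_and_discreteTopology_iff_s17.2 fun x => (h x).mono_right (principal_mono.2 hBA)

/-- A space partitioned into countably many pieces that are locally finite is a D-space. -/
theorem isDSpace_of_finite_fibers [T1Space X] (V : X → Set X) (hV : ∀ x, V x ∈ 𝓝 x)
    (c : X → ℕ) (hc : ∀ x n, {y ∈ V x | c y = n}.Finite) : IsDSpace X := by
  intro U hUo hU
  obtain ⟨D, hD⟩ : ∃ D : Set X, ∀ y, y ∈ D ↔ ∀ d, c d < c y → d ∈ D → y ∉ U d := by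
    let F : ∀ y : X, (∀ d, c d < c y → Prop) → Prop := fun y ih => ∀ d, ∀ h : c d < c y,
      ih d h → y ∉ U d
    refine ⟨{y | (measure c).wf.fix F y}, fun y => ?_⟩
    change (measure c).wf.fix F y ↔ _
    rw [WellFounded.fix_eq]
    rfl
  have hcov : ∀ x, ∃ d ∈ D, x ∈ U d := by
    intro x
    by_cases hx : x ∈ D
    · exact ⟨x, hx, hU x⟩
    · rw [hD] at hx
      push Not at hx
      obtain ⟨d, -, hd, hxd⟩ := hx
      exact ⟨d, hd, hxd⟩
  have hDcd : IsClosed D ∧ DiscreteTopology D := by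
    refine isClosed_and_discreteTopology_of_finite_inter fun x => ?_
    obtain ⟨d, hd, hxd⟩ := hcov x
    refine ⟨U d ∩ V x, inter_mem ((hUo d).mem_nhds hxd) (hV x), ?_⟩
    refine ((finite_Iic (c d)).biUnion fun n _ => hc x n).subset ?_
    rintro y ⟨⟨hyU, hyV⟩, hyD⟩
    refine mem_biUnion (x := c y) ?_ ⟨hyV, rfl⟩
    by_contra hlt
    exact (hD y).1 hyD d (not_le.1 hlt) hd hyU
  refine ⟨D, hDcd.1, hDcd.2, eq_univ_of_forall fun x => ?_⟩
  obtain ⟨d, hd, hxd⟩ := hcov x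
  exact mem_biUnion hd hxd

theorem IsDSpace.isADSpace (h : IsDSpace X) : IsADSpace X := by
  classical
  intro F hF 𝓤 h𝓤 hcov
  have hx : ∀ x, ∃ u ∈ 𝓤, x ∈ u := fun x => mem_sUnion.1 (hcov ▸ mem_univ x)
  choose φ hφ hxφ using hx
  obtain ⟨D, hDc, hDd, hD⟩ := h (fun x => if x ∈ F then φ x else Fᶜ)
    (fun x => by
      split_ifs
      exacts [h𝓤 _ (hφ x), hF.isOpen_compl])
    (fun x => by
      split_ifs with hxF
      exacts [hxφ x, hxF])
  obtain ⟨hAc, hAd⟩ := isClosed_and_discreteTopology_subset hDc hDd (inter_subset_left (t := F))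
  refine ⟨D ∩ F, inter_subset_right, hAc, hAd, φ, fun a _ => ⟨hφ a, hxφ a⟩, fun x hxF => ?_⟩
  obtain ⟨d, hd, hxd⟩ := mem_iUnion₂.1 (hD ▸ mem_univ x)
  split_ifs at hxd with hdF
  · exact mem_biUnion ⟨hd, hdF⟩ hxd
  · exact absurd hxF hxd

end LocallyFinite

section LocallyCompact

variable {X : Type*} [TopologicalSpace X] [T2Space X] [LocallyCompactSpace X]

theorem LocallyCountable.exists_isCompact_isOpen_countable (h : LocallyCountable X) (x : X) :
    ∃ V : Set X, x ∈ V ∧ IsCompact V ∧ IsOpen V ∧ V.Countable := by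
  obtain ⟨U, hU, hUc⟩ := h x
  obtain ⟨K, hK, hKU, hKc⟩ := LocallyCompactSpace.local_compact_nhds x U hU
  obtain ⟨f, hf0, hf1, -⟩ := exists_continuous_zero_one_of_isCompact
    (isCompact_singleton (x := x)) (isOpen_interior (s := K)).isClosed_compl
    (disjoint_singleton_left.2 fun hx => hx (mem_interior_iff_mem_nhds.2 hK))
  have hcount : (f '' K).Countable := (hUc.mono hKU).image f
  obtain ⟨r, ⟨hr0, hr1⟩, hr⟩ := not_subset.1 fun hsub : Ioo (0 : ℝ) 1 ⊆ f '' K =>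
    (Cardinal.Real.Ioo_countable_iff.1 (hcount.mono hsub)).not_gt one_pos
  have hK' : ∀ y, f y ≤ r → y ∈ K := fun y hy => by
    by_contra hyK
    have : f y = 1 := hf1 fun hy' => hyK (interior_subset hy')
    linarith
  have heq : {y | f y < r} = {y | f y ≤ r} := by
    ext y
    refine ⟨fun hy => le_of_lt (show f y < r from hy),
      fun hy => lt_of_le_of_ne (show f y ≤ r from hy) fun hyr => ?_⟩
    exact hr ⟨y, hK' y hy, hyr⟩
  refine ⟨{y | f y < r}, ?_, ?_, isOpen_lt f.continuous continuous_const,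
    (hUc.mono hKU).mono fun y hy => hK' y (le_of_lt hy)⟩
  · have : f x = 0 := hf0 rfl
    simpa [this] using hr0
  · rw [heq]
    exact hKc.of_isClosed_subset (isClosed_le f.continuous continuous_const) hK'

/-- The one-point compactification of a locally countable, locally compact Hausdorff aD-space is
countably tight. -/
theorem IsADSpace.countablyTight_onePoint (h : IsADSpace X) (hlc : LocallyCountable X) :
    CountablyTight (OnePoint X) := by
  choose V hxV hVcomp hVopen hVcount using hlc.exists_isCompact_isOpen_countable
  intro T hT
  have hF : IsClosed ((↑) ⁻¹' T : Set X) := by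
    rw [← closure_subset_iff_isClosed]
    intro x hx
    have hx' : x ∈ closure ((↑) ⁻¹' T ∩ V x : Set X) := by
      rw [mem_closure_iff_nhds] at hx ⊢
      intro s hs
      obtain ⟨y, ⟨hy1, hy2⟩, hy3⟩ := hx (s ∩ V x) (inter_mem hs ((hVopen x).mem_nhds (hxV x)))
      exact ⟨y, hy1, hy3, hy2⟩
    refine hT ((↑) '' ((↑) ⁻¹' T ∩ V x : Set X)) (image_subset_iff.2 inter_subset_left)
      (((hVcount x).mono inter_subset_right).image _) ?_
    exact image_closure_subset_closure_image OnePoint.continuous_coe (mem_image_of_mem _ hx')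
  by_cases hinf : OnePoint.infty ∈ T
  · rwa [OnePoint.isClosed_iff_of_mem hinf]
  · rw [OnePoint.isClosed_iff_of_notMem hinf]
    refine ⟨hF, ?_⟩
    obtain ⟨A, hAF, hAc, hAd, φ, hφ, hcov⟩ := h _ hF (range V)
      (by rintro _ ⟨x, rfl⟩; exact hVopen x)
      (eq_univ_of_forall fun x => mem_sUnion.2 ⟨V x, mem_range_self x, hxV x⟩)
    have hAfin : A.Finite := by
      by_contra hinfA
      obtain ⟨B, hBA, hBinf, hBc⟩ : ∃ B ⊆ A, B.Infinite ∧ B.Countable := by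
        have := Set.Infinite.to_subtype hinfA
        refine ⟨range fun n => (Infinite.natEmbedding A n : X), ?_, ?_, countable_range _⟩
        · rintro _ ⟨n, rfl⟩
          exact Subtype.coe_prop _
        · exact infinite_range_of_injective
            (Subtype.val_injective.comp (Infinite.natEmbedding A).injective)
      obtain ⟨hBcl, hBd⟩ := isClosed_and_discreteTopology_subset hAc hAd hBA
      have hcl := hT ((↑) '' B) (image_subset_iff.2 (hBA.trans hAF)) (hBc.image _)
      have hBclosed : IsClosed ((↑) '' B : Set (OnePoint X)) := by
        rw [← closure_subset_iff_isClosed]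
        intro z hz
        induction z using OnePoint.rec with
        | infty => exact absurd (hcl hz) hinf
        | coe x =>
          refine mem_image_of_mem _ ?_
          rw [← hBcl.closure_eq,
            OnePoint.isOpenEmbedding_coe.isInducing.closure_eq_preimage_closure_image]
          exact hz
      exact hBinf ((OnePoint.isClosed_image_coe.1 hBclosed).2.finite
        (isDiscrete_iff_discreteTopology.2 hBd))
    refine (hAfin.isCompact_biUnion fun a ha => ?_).of_isClosed_subset hF hcov
    obtain ⟨x, hx⟩ := (hφ a ha).1
    exact hx ▸ hVcomp x

end LocallyCompact

section MartinsAxiom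

universe u

/-- Martin's Axiom for partial orders in an arbitrary universe that are small, with the dense sets
given as an indexed family. -/
theorem MartinsAxiom.exists_filter (hMA : MartinsAxiom) {P : Type u} [PartialOrder P]
    [Small.{0} P] [Nonempty P]
    (hccc : ∀ A : Set P, (∀ p ∈ A, ∀ q ∈ A, p ≠ q → ¬∃ r, r ≤ p ∧ r ≤ q) → A.Countable)
    {ι : Type u} (hι : #ι < 2 ^ Cardinal.aleph0) (D : ι → Set P)
    (hD : ∀ i, ∀ p, ∃ q ∈ D i, q ≤ p) :
    ∃ G : Set P, (∀ p ∈ G, ∀ q ∈ G, ∃ r ∈ G, r ≤ p ∧ r ≤ q) ∧ ∀ i, (G ∩ D i).Nonempty := by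
  let e : P ≃ Shrink.{0} P := equivShrink P
  let _ : PartialOrder (Shrink.{0} P) := PartialOrder.lift e.symm e.symm.injective
  have hle : ∀ p q : Shrink.{0} P, p ≤ q ↔ e.symm p ≤ e.symm q := fun _ _ => Iff.rfl
  have hcard : #(range fun i => e '' D i) < 2 ^ Cardinal.aleph0.{0} := by
    have h := mk_range_le_lift (f := fun i => e '' D i)
    have h' := h.trans_lt (lift_strictMono hι)
    rw [lift_two_power, lift_aleph0] at h'
    rw [← lift_lt.{0, u}, lift_two_power, lift_aleph0]
    exact h'
  obtain ⟨G, -, -, hG, hGD⟩ := hMA (Shrink.{0} P) ⟨e (Classical.arbitrary P)⟩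
    (by
      intro A hA
      refine countable_of_injective_of_countable_image (f := e.symm) e.symm.injective.injOn
        (hccc _ ?_)
      rintro _ ⟨p, hp, rfl⟩ _ ⟨q, hq, rfl⟩ hpq ⟨r, hrp, hrq⟩
      refine hA p hp q hq (fun h => hpq (h ▸ rfl)) ⟨e r, ?_, ?_⟩ <;> simpa [hle])
    (range fun i => e '' D i)
    (by
      rintro _ ⟨i, rfl⟩ p
      obtain ⟨q, hq, hqp⟩ := hD i (e.symm p)
      exact ⟨e q, mem_image_of_mem _ hq, by simpa [hle]⟩)
    hcard
  refine ⟨e.symm '' G, ?_, fun i => ?_⟩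
  · rintro _ ⟨p, hp, rfl⟩ _ ⟨q, hq, rfl⟩
    obtain ⟨r, hr, hrp, hrq⟩ := hG p hp q hq
    exact ⟨e.symm r, mem_image_of_mem _ hr, hrp, hrq⟩
  · obtain ⟨_, hx, ⟨p, hp, rfl⟩⟩ := hGD _ (mem_range_self i)
    exact ⟨p, ⟨e p, hx, e.symm_apply_apply p⟩, hp⟩

theorem small_of_mk_lt_two_power_aleph0 {X : Type u} (h : #X < 2 ^ Cardinal.aleph0) :
    Small.{0} X := by
  have h' : lift.{0} #X ≤ lift.{u} #(Set ℕ) := by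
    rw [mk_set, mk_nat, lift_two_power, lift_aleph0, lift_uzero]
    exact h.le
  obtain ⟨f⟩ := lift_mk_le'.1 h'
  exact small_of_injective f.injective

end MartinsAxiom

section Forcing

universe u

/-- An uncountable family of finite sets has an uncountable subfamily whose members contain a
common root `r` outside of which every point lies in only countably many members. -/
theorem exists_uncountable_root {α Z : Type*} {A : Set α} (f : α → Finset Z)
    (hA : ¬A.Countable) : ∃ B ⊆ A, ¬B.Countable ∧ ∃ r : Finset Z,
      (∀ p ∈ B, r ⊆ f p) ∧ ∀ z ∉ r, {p ∈ B | z ∈ f p}.Countable := by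
  classical
  obtain ⟨n, hn⟩ : ∃ n, ¬{p ∈ A | (f p).card = n}.Countable := by
    by_contra hcon
    push Not at hcon
    refine hA ((countable_iUnion hcon).mono fun p hp => ?_)
    exact mem_iUnion.2 ⟨(f p).card, hp, rfl⟩
  set K : Set ℕ := {k | ∃ r : Finset Z, r.card = k ∧
    ¬{p ∈ A | (f p).card = n ∧ r ⊆ f p}.Countable} with hK
  have hK0 : K.Nonempty := ⟨0, ∅, rfl, by simpa using hn⟩
  have hKb : BddAbove K := by
    refine ⟨n, ?_⟩
    rintro k ⟨r, rfl, hr⟩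
    by_contra hlt
    refine hr (countable_empty.mono ?_)
    rintro p ⟨-, hp, hrp⟩
    exact hlt (hp ▸ Finset.card_le_card hrp)
  obtain ⟨r, hrk, hr⟩ := Nat.sSup_mem hK0 hKb
  refine ⟨_, fun p hp => hp.1, hr, r, fun p hp => hp.2.2, fun z hz => ?_⟩
  by_contra hunc
  have : (insert z r).card ∈ K := by
    refine ⟨_, rfl, fun hc => hunc (hc.mono ?_)⟩
    rintro p ⟨⟨hpA, hpn, hrp⟩, hzp⟩
    exact ⟨hpA, hpn, Finset.insert_subset hzp hrp⟩
  have hle := le_csSup hKb this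
  rw [Finset.card_insert_of_notMem hz, hrk] at hle
  omega

/-- Conditions of the forcing that adds a set `D` with `{z ∈ D | R z w}` finite for many `w`:
the finite set `pos` is a part of `D`, and for `w` in the finite set `closed` no further `z` with
`R z w` may be added to `D`. -/
@[ext]
structure FiniteCondition {Z : Type u} (R : Z → Z → Prop) where
  pos : Finset Z
  closed : Finset Z

namespace FiniteCondition

variable {Z : Type u} {R : Z → Z → Prop}

instance : PartialOrder (FiniteCondition R) where
  le q p := p.pos ⊆ q.pos ∧ p.closed ⊆ q.closed ∧
    ∀ z ∈ q.pos, ∀ w ∈ p.closed, R z w → z ∈ p.pos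
  le_refl p := ⟨Finset.Subset.refl _, Finset.Subset.refl _, fun _ hz _ _ _ => hz⟩
  le_trans r q p h₁ h₂ := ⟨h₂.1.trans h₁.1, h₂.2.1.trans h₁.2.1, fun z hz w hw hR =>
    h₂.2.2 z (h₁.2.2 z hz w (h₂.2.1 hw) hR) w hw hR⟩
  le_antisymm p q h₁ h₂ := FiniteCondition.ext (h₂.1.antisymm h₁.1) (h₂.2.1.antisymm h₁.2.1)

theorem le_def {p q : FiniteCondition R} : q ≤ p ↔ p.pos ⊆ q.pos ∧ p.closed ⊆ q.closed ∧
    ∀ z ∈ q.pos, ∀ w ∈ p.closed, R z w → z ∈ p.pos := Iff.rfl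

instance : Nonempty (FiniteCondition R) := ⟨⟨∅, ∅⟩⟩

instance [Small.{0} Z] : Small.{0} (FiniteCondition R) := by
  have : Small.{0} (Finset Z) :=
    small_of_injective (f := fun s : Finset Z => (s : Set Z)) Finset.coe_injective
  exact small_of_injective (f := fun p : FiniteCondition R => (p.pos, p.closed))
    fun p q h => FiniteCondition.ext (Prod.ext_iff.1 h).1 (Prod.ext_iff.1 h).2

theorem exists_conflict {p q : FiniteCondition R} (h : ¬∃ r, r ≤ p ∧ r ≤ q) :
    (∃ z ∈ p.pos, z ∉ q.pos ∧ ∃ w ∈ q.closed, R z w) ∨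
      ∃ z ∈ q.pos, z ∉ p.pos ∧ ∃ w ∈ p.closed, R z w := by
  classical
  by_contra hcon
  push Not at hcon
  refine h ⟨⟨p.pos ∪ q.pos, p.closed ∪ q.closed⟩, ?_, ?_⟩
  · refine ⟨Finset.subset_union_left, Finset.subset_union_left, fun z hz w hw hR => ?_⟩
    by_contra hzp
    exact hcon.2 z ((Finset.mem_union.1 hz).resolve_left hzp) hzp w hw hR
  · refine ⟨Finset.subset_union_right, Finset.subset_union_right, fun z hz w hw hR => ?_⟩
    by_contra hzq
    exact hcon.1 z ((Finset.mem_union.1 hz).resolve_right hzq) hzq w hw hR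

/-- An uncountable antichain of conditions has an uncountable subfamily in which, up to countable
sets, the conflicts go in one direction only. -/
theorem exists_uncountable_oneSided (hR : ∀ w, {z | R z w}.Countable)
    {A : Set (FiniteCondition R)}
    (hanti : ∀ p ∈ A, ∀ q ∈ A, p ≠ q → ¬∃ r, r ≤ p ∧ r ≤ q) (hA : ¬A.Countable) :
    ∃ B : Set (FiniteCondition R), ¬B.Countable ∧ ∃ a : FiniteCondition R → Finset Z,
      ∀ p ∈ B, {q ∈ B | ¬((∃ z ∈ a p, ∃ w ∈ q.closed, R z w) ∧
        ¬∃ z ∈ a q, ∃ w ∈ p.closed, R z w)}.Countable := by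
  classical
  obtain ⟨B, hBA, hB, r, hrB, hr⟩ := exists_uncountable_root (fun p : FiniteCondition R => p.pos) hA
  refine ⟨B, hB, fun p => p.pos \ r, fun p hp => ?_⟩
  have h1 : (⋃ w ∈ p.closed, ⋃ z ∈ {z | R z w} \ r, {q ∈ B | z ∈ q.pos}).Countable :=
    p.closed.countable_toSet.biUnion fun w _ =>
      ((hR w).mono sdiff_subset).biUnion fun z hz => hr z hz.2
  refine (h1.union (countable_singleton p)).mono ?_
  rintro q ⟨hqB, hq⟩
  by_contra hcon
  simp only [mem_union, mem_iUnion, not_or, not_exists, mem_singleton_iff] at hcon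
  obtain ⟨hc1, hc3⟩ := hcon
  have hnot : ¬∃ z ∈ q.pos \ r, ∃ w ∈ p.closed, R z w := by
    rintro ⟨z, hz, w, hw, hzw⟩
    exact hc1 w hw z ⟨hzw, (Finset.mem_sdiff.1 hz).2⟩ ⟨hqB, (Finset.mem_sdiff.1 hz).1⟩
  refine hq ⟨?_, hnot⟩
  rcases exists_conflict (hanti p (hBA hp) q (hBA hqB) (Ne.symm hc3)) with
    ⟨z, hzp, hzq, w, hw, hzw⟩ | ⟨z, hzq, hzp, w, hw, hzw⟩
  · exact ⟨z, Finset.mem_sdiff.2 ⟨hzp, fun hz => hzq (hrB q hqB hz)⟩, w, hw, hzw⟩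
  · exact absurd ⟨z, Finset.mem_sdiff.2 ⟨hzq, fun hz => hzp (hrB p hp hz)⟩, w, hw, hzw⟩ hnot

end FiniteCondition
end Forcing

section Main

universe u

variable {X : Type u}

/-- The relation on `X × ℕ` which places a copy of the neighborhoods `V` in each slice. -/
def sliceRel (V : X → Set X) (z w : X × ℕ) : Prop := z.1 ∈ V w.1 ∧ z.2 = w.2

theorem countable_setOf_sliceRel {V : X → Set X} (hV : ∀ x, (V x).Countable) (w : X × ℕ) :
    {z | sliceRel V z w}.Countable := by
  refine ((hV w.1).prod (countable_singleton w.2)).mono fun z hz => ?_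
  exact mem_prod.2 ⟨hz.1, hz.2⟩

theorem countable_antichain_sliceRel [TopologicalSpace X] [T2Space X] [LocallyCompactSpace X]
    (hX : CountablyTight (OnePoint X)) {V : X → Set X} (hVo : ∀ x, IsOpen (V x))
    (hVc : ∀ x, IsCompact (V x)) (hV : ∀ x, (V x).Countable)
    (A : Set (FiniteCondition (sliceRel V)))
    (hA : ∀ p ∈ A, ∀ q ∈ A, p ≠ q → ¬∃ r, r ≤ p ∧ r ≤ q) : A.Countable := by
  by_contra hAc
  obtain ⟨B, hB, a, ha⟩ :=
    FiniteCondition.exists_uncountable_oneSided (countable_setOf_sliceRel hV) hA hAc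
  obtain ⟨l, hl⟩ : ∃ l : List ℕ, ¬{p ∈ B | (a p).toList.map Prod.snd = l}.Countable := by
    by_contra hcon
    push Not at hcon
    refine hB ((countable_iUnion hcon).mono fun p hp => ?_)
    exact mem_iUnion.2 ⟨(a p).toList.map Prod.snd, hp, rfl⟩
  let pt : FiniteCondition (sliceRel V) → Fin l.length → OnePoint X :=
    fun p i => (a p).toList[i.1]?.elim OnePoint.infty fun z => z.1
  let W : FiniteCondition (sliceRel V) → Set (Fin l.length → OnePoint X) :=
    fun q => ⋃ i : Fin l.length, ⋃ w ∈ {w ∈ q.closed | w.2 = l[i]},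
      (fun y => y i) ⁻¹' ((↑) '' V w.1)
  have hW : ∀ q, IsClopen (W q) := fun q => isClopen_iUnion_of_finite fun i =>
    isClopen_biUnion_finset fun w _ => IsClopen.preimage
      ⟨OnePoint.isClosed_image_coe.2 ⟨(hVc _).isClosed, hVc _⟩,
        OnePoint.isOpen_image_coe.2 (hVo _)⟩ (continuous_apply i)
  have key : ∀ p q, (a p).toList.map Prod.snd = l →
      (pt p ∈ W q ↔ ∃ z ∈ a p, ∃ w ∈ q.closed, sliceRel V z w) := by
    intro p q hp
    have hlen : (a p).toList.length = l.length := by rw [← hp, List.length_map]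
    simp only [W, pt, mem_iUnion, mem_preimage, Finset.mem_filter]
    constructor
    · rintro ⟨i, w, ⟨hwq, hwi⟩, x, hx, hxi⟩
      have hi : i.1 < (a p).toList.length := i.2.trans_eq hlen.symm
      rw [List.getElem?_eq_getElem hi] at hxi
      refine ⟨(a p).toList[i.1], Finset.mem_toList.1 (List.getElem_mem hi), w, hwq, ?_, ?_⟩
      · rw [← OnePoint.coe_injective hxi]
        exact hx
      · simp [hwi, ← hp]
    · rintro ⟨z, hz, w, hwq, hzw1, hzw2⟩
      obtain ⟨i, hi, rfl⟩ := List.getElem_of_mem (Finset.mem_toList.2 hz)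
      refine ⟨⟨i, hi.trans_eq hlen⟩, w, ⟨hwq, ?_⟩, _, hzw1, ?_⟩
      · simp [← hzw2, ← hp]
      · simp [List.getElem?_eq_getElem hi]
  refine hl ((hX.pi_fin l.length).countable_of_clopen _ pt W (fun q _ => hW q) ?_)
  rintro p ⟨hpB, hpl⟩
  refine (ha p hpB).mono ?_
  rintro q ⟨⟨hqB, hql⟩, hq⟩
  exact ⟨hqB, fun h => hq ⟨(key p q hpl).2 h.1, fun h' => h.2 ((key q p hql).1 h')⟩⟩

/-- The partition of `X` into countably many pieces given by Martin's Axiom. -/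
theorem MartinsAxiom.exists_finite_fibers (hMA : MartinsAxiom) (hX : #X < 2 ^ Cardinal.aleph0)
    (V : X → Set X)
    (hccc : ∀ A : Set (FiniteCondition (sliceRel V)),
      (∀ p ∈ A, ∀ q ∈ A, p ≠ q → ¬∃ r, r ≤ p ∧ r ≤ q) → A.Countable) :
    ∃ c : X → ℕ, ∀ x n, {y ∈ V x | c y = n}.Finite := by
  classical
  have := small_of_mk_lt_two_power_aleph0 hX
  have hX' : #(X ⊕ X × ℕ) < 2 ^ Cardinal.aleph0.{u} := by
    have h0 : Cardinal.aleph0.{u} < 2 ^ Cardinal.aleph0.{u} := cantor _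
    simp only [mk_sum, mk_prod, lift_id, lift_uzero, mk_nat, lift_aleph0]
    exact add_lt_of_lt h0.le hX (mul_lt_of_lt h0.le hX h0)
  obtain ⟨G, hG, hGD⟩ := hMA.exists_filter hccc hX'
    (Sum.elim (fun x => {p | ∃ n, (x, n) ∈ p.pos}) fun w => {p | w ∈ p.closed}) (by
      rintro (x | w) p
      · obtain ⟨n, hn⟩ := Infinite.exists_notMem_finset (p.closed.image Prod.snd)
        refine ⟨⟨insert (x, n) p.pos, p.closed⟩, ⟨n, Finset.mem_insert_self _ _⟩,
          Finset.subset_insert _ _, Finset.Subset.refl _, fun z hz w hw hzw => ?_⟩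
        rcases Finset.mem_insert.1 hz with rfl | hz
        · exact absurd (Finset.mem_image.2 ⟨w, hw, hzw.2.symm⟩) hn
        · exact hz
      · exact ⟨⟨p.pos, insert w p.closed⟩, Finset.mem_insert_self _ _,
          Finset.Subset.refl _, Finset.subset_insert _ _, fun z hz _ _ _ => hz⟩)
  have hpos : ∀ x, ∃ n, ∃ p ∈ G, (x, n) ∈ p.pos := fun x => by
    obtain ⟨p, hp, n, hn⟩ := hGD (Sum.inl x)
    exact ⟨n, p, hp, hn⟩
  choose c hc using hpos
  refine ⟨c, fun x n => ?_⟩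
  obtain ⟨p, hp, hxp⟩ := hGD (Sum.inr (x, n))
  refine ((p.pos.image Prod.fst).finite_toSet).subset ?_
  rintro y ⟨hyV, rfl⟩
  obtain ⟨q, hq, hyq⟩ := hc y
  obtain ⟨r, -, hrp, hrq⟩ := hG p hp q hq
  exact Finset.mem_coe.2 (Finset.mem_image.2
    ⟨(y, c y), hrp.2.2 _ (hrq.1 hyq) (x, c y) hxp ⟨hyV, rfl⟩, rfl⟩)

end Main

/-- Under MA, a locally countable, locally compact Hausdorff space of
cardinality `< 2^ℵ₀` is a D-space iff it is an aD-space. -/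
theorem stmt17 (hMA : MartinsAxiom) (X : Type*) [TopologicalSpace X] [T2Space X]
    (h1 : LocallyCountable X) (h2 : LocallyCompactSpace X)
    (hcard : #X < 2 ^ Cardinal.aleph0) :
    IsDSpace X ↔ IsADSpace X := by
  refine ⟨IsDSpace.isADSpace, fun h => ?_⟩
  choose V hxV hVcomp hVopen hVcount using h1.exists_isCompact_isOpen_countable
  obtain ⟨c, hc⟩ := hMA.exists_finite_fibers hcard V
    (countable_antichain_sliceRel (h.countablyTight_onePoint h1) hVopen hVcomp hVcount)
  exact isDSpace_of_finite_fibers V (fun x => (hVopen x).mem_nhds (hxV x)) c hc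
end
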